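/- arXiv:math/0101076 — 2 statements merged into one kernel-verified Lean document; each statement's English description precedes it below -/
import Mathlib

section
/- For n > d ≥ 2 and S = {s_1 < ... < s_r} ⊆ {0,...,d-1} with s_{r+1} := d, the difference f_S(Q^{d,m}) - f_S(T^d) equals the multinomial coefficient (d+1)!/((s_1+1)!(s_2-s_1)!...(d-s_r)!) times m/((d+1)d(d-1)) · Σ_{j=1}^r (s_j+1)(s_{j+1}-s_j)(s_{j+1}-1), where Q^{d,m} is the (d-2)-fold pyramid over the (m+3)-gon and T^d is the d-simplex. -/
open Set

variable {E : Type*} [NormedAddCommGroup E] [NormedSpace ℝ E]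

/-- The dimension of a (nonempty convex) set: the dimension of its affine span. -/
noncomputable def pdim (F : Set E) : ℕ := Module.finrank ℝ (affineSpan ℝ F).direction

/-- `F` is a (nonempty) face of the polytope `P`. -/
def IsFaceOf (P F : Set E) : Prop := IsExposed ℝ P F ∧ F.Nonempty

/-- The number of `i`-dimensional faces of `P`. -/
noncomputable def faceCount (P : Set E) (i : ℕ) : ℕ :=
  {F : Set E | IsFaceOf P F ∧ pdim F = i}.ncard

/-- The flag number `f_S(P)`: the number of chains of faces of `P` whose set of
dimensions is `S`.  A chain is recorded as a function `c : ℕ → Set E` that assigns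
to each `s ∈ S` a face of dimension `s`, increasingly with `s`, and `∅` off `S`. -/
noncomputable def flagNum (P : Set E) (S : Finset ℕ) : ℕ :=
  {c : ℕ → Set E | (∀ s ∈ S, IsFaceOf P (c s) ∧ pdim (c s) = s) ∧
    (∀ s ∈ S, ∀ t ∈ S, s ≤ t → c s ⊆ c t) ∧ ∀ s, s ∉ S → c s = ∅}.ncard

/-- `P` is the multiplex `M^{d,n}` with ordered vertices `x 0, …, x n`, where the
vertex list is extended to all integer indices by the conventions `x j = x 0` for
`j < 0` and `x j = x n` for `j > n`.  Its facets are exactly the sets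
`F i = conv{x (i-d+1), …, x (i-1), x (i+1), …, x (i+d-1)}` for `0 ≤ i ≤ n`. -/
structure IsMultiplex (d n : ℕ) (P : Set E) (x : ℤ → E) : Prop where
  two_le_d : 2 ≤ d
  d_le_n : d ≤ n
  clamp_lo : ∀ j : ℤ, j ≤ 0 → x j = x 0
  clamp_hi : ∀ j : ℤ, (n : ℤ) ≤ j → x j = x n
  inj : Set.InjOn x (Icc (0:ℤ) (n:ℤ))
  hull : P = convexHull ℝ (x '' Icc (0:ℤ) (n:ℤ))
  verts : Set.extremePoints ℝ P = x '' Icc (0:ℤ) (n:ℤ)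
  dim : pdim P = d
  facets : ∀ F : Set E, (IsFaceOf P F ∧ pdim F = d - 1) ↔
      ∃ i ∈ Icc (0:ℤ) (n:ℤ),
        F = convexHull ℝ (x '' (Icc (i - d + 1) (i + d - 1) \ {i}))

/-- `Q` is a `k`-fold pyramid over the base `B`: `Q` is obtained from `B` by
iterating the pyramid construction (taking the convex hull with a new apex
outside the affine span) `k` times. -/
def IsKFoldPyramid : ℕ → Set E → Set E → Prop
  | 0, Q, B => Q = B
  | (k + 1), Q, B => ∃ (R : Set E) (a : E), IsKFoldPyramid k R B ∧
      a ∉ affineSpan ℝ R ∧ Q = convexHull ℝ (insert a R)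

/-- `B` is an `m`-gon: a two-dimensional polytope with exactly `m` vertices. -/
def IsPolygon (m : ℕ) (B : Set E) : Prop :=
  ∃ v : Finset E, v.card = m ∧ B = convexHull ℝ (v : Set E) ∧
    Set.extremePoints ℝ B = (v : Set E) ∧ pdim B = 2


open Classical in
/-- rank of a face: dimension plus one, and zero for the empty face -/
noncomputable def rk (F : Set E) : ℕ := if F = ∅ then 0 else pdim F + 1


theorem rk_empty : rk (∅ : Set E) = 0 := by simp [rk]

theorem rk_of_nonempty {F : Set E} (h : F.Nonempty) : rk F = pdim F + 1 := by
  simp [rk, h.ne_empty]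

theorem rk_eq_zero {F : Set E} : rk F = 0 ↔ F = ∅ := by
  by_cases h : F = ∅ <;> simp [rk, h]

theorem pdim_mono {F G : Set E} (h : F ⊆ G)
    (hG : FiniteDimensional ℝ (affineSpan ℝ G).direction) : pdim F ≤ pdim G :=
  Submodule.finrank_mono (AffineSubspace.direction_le (affineSpan_mono ℝ h))

theorem rk_mono {F G : Set E} (h : F ⊆ G)
    (hG : FiniteDimensional ℝ (affineSpan ℝ G).direction) : rk F ≤ rk G := by
  rcases F.eq_empty_or_nonempty with rfl | hF
  · simp [rk_empty]
  · rw [rk_of_nonempty hF, rk_of_nonempty (hF.mono h)]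
    exact Nat.succ_le_succ (pdim_mono h hG)

theorem fd_mono {F G : Set E} (h : F ⊆ G)
    (hG : FiniteDimensional ℝ (affineSpan ℝ G).direction) :
    FiniteDimensional ℝ (affineSpan ℝ F).direction :=
  Submodule.finiteDimensional_of_le (AffineSubspace.direction_le (affineSpan_mono ℝ h))

/-- a functional constant on a set is constant on its affine span -/
theorem const_on_span {F : Set E} (l : StrongDual ℝ E) (c : ℝ) (h : ∀ x ∈ F, l x = c) :
    ∀ x ∈ affineSpan ℝ F, l x = c := by
  intro x hx
  refine affineSpan_induction (p := fun x => l x = c) hx h ?_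
  intro t u v w hu hv hw
  simp [hu, hv, hw]

/-- a face of full rank is everything -/
theorem face_full {P F : Set E} (hP : FiniteDimensional ℝ (affineSpan ℝ P).direction)
    (h : IsExposed ℝ P F) (hr : rk F = rk P) : F = P := by
  rcases F.eq_empty_or_nonempty with rfl | hF
  · rw [rk_empty] at hr; exact (rk_eq_zero.1 hr.symm).symm
  · have hs := h.subset
    rw [rk_of_nonempty hF, rk_of_nonempty (hF.mono hs)] at hr
    have hspan : affineSpan ℝ F = affineSpan ℝ P := by
      apply AffineSubspace.eq_of_direction_eq_of_nonempty_of_le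
      · apply Submodule.eq_of_le_of_finrank_eq
          (AffineSubspace.direction_le (affineSpan_mono ℝ hs))
        simpa [pdim] using hr
      · exact (affineSpan_nonempty ℝ).2 hF
      · exact affineSpan_mono ℝ hs
    obtain ⟨l, hl⟩ := h hF
    obtain ⟨x, hx⟩ := hF
    have hc : ∀ y ∈ F, l y = l x := by
      intro y hy
      rw [hl] at hx hy
      exact le_antisymm (hx.2 y hy.1) (hy.2 x hx.1)
    have hc' : ∀ y ∈ P, l y = l x := fun y hy =>
      const_on_span l (l x) hc y (by rw [hspan]; exact subset_affineSpan ℝ P hy)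
    apply hs.antisymm
    intro y hy
    rw [hl]
    refine ⟨hy, fun z hz => ?_⟩
    rw [hc' y hy, hc' z hz]

theorem exists_phi {R : Set E} (hR : FiniteDimensional ℝ (affineSpan ℝ R).direction) {a : E}
    (ha : a ∉ affineSpan ℝ R) :
    ∃ (φ : StrongDual ℝ E) (c : ℝ), (∀ x ∈ R, φ x = c) ∧ c < φ a := by
  rcases R.eq_empty_or_nonempty with rfl | ⟨r, hr⟩
  · exact ⟨0, -1, by simp, by simp⟩
  · have hnm : a - r ∉ (affineSpan ℝ R).direction := by
      intro h
      apply ha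
      have := AffineSubspace.vadd_mem_of_mem_direction h (subset_affineSpan ℝ R hr)
      simpa using this
    have hcl : IsClosed ((affineSpan ℝ R).direction : Set E) :=
      Submodule.closed_of_finiteDimensional _
    obtain ⟨f, u, h1, h2⟩ := geometric_hahn_banach_closed_point
      (Submodule.convex _) hcl hnm
    have hz : ∀ x ∈ (affineSpan ℝ R).direction, f x = 0 := by
      intro x hx
      by_contra hne
      have := h1 (((u + 1) / f x) • x) (Submodule.smul_mem _ _ hx)
      rw [map_smul, smul_eq_mul, div_mul_cancel₀ _ hne] at this
      linarith
    refine ⟨f, f r, ?_, ?_⟩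
    · intro x hx
      have := hz (x - r) (AffineSubspace.vsub_mem_direction (subset_affineSpan ℝ R hx)
        (subset_affineSpan ℝ R hr))
      rw [map_sub] at this
      linarith
    · have h0 := h1 0 (Submodule.zero_mem _)
      rw [map_zero] at h0
      rw [map_sub] at h2
      linarith

theorem mem_pyr {R : Set E} (hR : Convex ℝ R) {a x : E} :
    x ∈ convexHull ℝ (insert a R) ↔
      x = a ∨ ∃ r ∈ R, ∃ t : ℝ, 0 < t ∧ t ≤ 1 ∧ x = a + t • (r - a) := by
  rcases R.eq_empty_or_nonempty with rfl | hne
  · simp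
  · rw [convexHull_insert hne, hR.convexHull_eq, convexJoin_singleton_left]
    simp only [mem_iUnion, segment_eq_image', mem_image, mem_Icc, exists_prop]
    constructor
    · rintro ⟨r, hr, t, ⟨h0, h1⟩, rfl⟩
      rcases h0.eq_or_lt with rfl | h0
      · left; simp
      · right; exact ⟨r, hr, t, h0, h1, rfl⟩
    · rintro (rfl | ⟨r, hr, t, h0, h1, rfl⟩)
      · obtain ⟨r, hr⟩ := hne
        exact ⟨r, hr, 0, by simp, by simp⟩
      · exact ⟨r, hr, t, ⟨h0.le, h1⟩, rfl⟩

theorem map_pyr (l : StrongDual ℝ E) (a r : E) (t : ℝ) :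
    l (a + t • (r - a)) = l a + t * (l r - l a) := by simp

theorem subset_pyr {R : Set E} {a : E} : R ⊆ convexHull ℝ (insert a R) :=
  (subset_insert a R).trans (subset_convexHull ℝ _)

theorem apex_mem {R : Set E} {a : E} : a ∈ convexHull ℝ (insert a R) :=
  subset_convexHull ℝ _ (mem_insert a R)

theorem face_inter {P R G : Set E} (hRP : R ⊆ P) (h : IsExposed ℝ P G) :
    IsExposed ℝ R (G ∩ R) := by
  rintro ⟨w, hw, hwR⟩
  obtain ⟨l, rfl⟩ := h ⟨w, hw⟩
  refine ⟨l, Subset.antisymm ?_ ?_⟩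
  · rintro x ⟨hx, hxR⟩
    exact ⟨hxR, fun y hy => hx.2 y (hRP hy)⟩
  · rintro x ⟨hx, hx2⟩
    exact ⟨⟨hRP hx, fun y hy => (hw.2 y hy).trans (hx2 w hwR)⟩, hx⟩

theorem inter_one {R F : Set E} (hF : Convex ℝ F) (hFR : F ⊆ R) {a : E} {φ : StrongDual ℝ E} {c : ℝ}
    (hφ : ∀ x ∈ R, φ x = c) (ha : c < φ a) :
    convexHull ℝ (insert a F) ∩ R = F := by
  apply Subset.antisymm
  · rintro x ⟨hx, hxR⟩
    rcases (mem_pyr hF).1 hx with rfl | ⟨r, hr, t, h0, h1, rfl⟩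
    · exact absurd (hφ _ hxR) ha.ne'
    · have h2 := hφ _ hxR
      rw [map_pyr, hφ r (hFR hr)] at h2
      have h3 : t = 1 := by
        have : (1 - t) * (φ a - c) = 0 := by linarith
        rcases mul_eq_zero.1 this with h | h <;> linarith
      subst h3
      simpa using hr
  · exact fun x hx => ⟨subset_pyr hx, hFR hx⟩

theorem face_eq {R G : Set E} (hR : Convex ℝ R) {a : E}
    (h : IsExposed ℝ (convexHull ℝ (insert a R)) G) :
    (a ∉ G → G ⊆ R) ∧ (a ∈ G → G = convexHull ℝ (insert a (G ∩ R))) := by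
  have hcG : Convex ℝ G := h.convex (convex_convexHull ℝ _)
  constructor
  · intro haG x hx
    obtain ⟨l, rfl⟩ := h ⟨x, hx⟩
    rcases (mem_pyr hR).1 hx.1 with rfl | ⟨r, hr, t, h0, h1, rfl⟩
    · exact absurd hx haG
    · have h2 := hx.2 r (subset_pyr hr)
      have h3 : l a < l (a + t • (r - a)) := by
        by_contra! h4
        exact haG ⟨apex_mem, fun y hy => (hx.2 y hy).trans h4⟩
      rw [map_pyr] at h2 h3
      have h5 : 0 < l r - l a := pos_of_mul_pos_right (by linarith) h0.le
      have h6 : t = 1 := by nlinarith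
      subst h6
      simpa using hr
  · intro haG
    apply Subset.antisymm
    · intro x hx
      obtain ⟨l, rfl⟩ := h ⟨x, hx⟩
      apply (mem_pyr (hcG.inter hR)).2
      rcases (mem_pyr hR).1 hx.1 with rfl | ⟨r, hr, t, h0, h1, rfl⟩
      · left; rfl
      · right
        refine ⟨r, ⟨⟨subset_pyr hr, fun y hy => ?_⟩, hr⟩, t, h0, h1, rfl⟩
        have h2 := hx.2 a apex_mem
        rw [map_pyr] at h2
        have h5 : 0 ≤ l r - l a := nonneg_of_mul_nonneg_right (by linarith) h0
        have := haG.2 y hy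
        linarith
    · exact convexHull_min (insert_subset haG inter_subset_left) hcG

theorem face_zero {R F : Set E} (hR : Convex ℝ R) {a : E} {φ : StrongDual ℝ E} {c : ℝ}
    (hφ : ∀ x ∈ R, φ x = c) (ha : c < φ a) (h : IsExposed ℝ R F) :
    IsExposed ℝ (convexHull ℝ (insert a R)) F := by
  rintro ⟨w, hw⟩
  obtain ⟨l, rfl⟩ := h ⟨w, hw⟩
  obtain ⟨τ, hτ⟩ : ∃ τ : ℝ, (l + τ • φ) a < (l + τ • φ) w := by
    refine ⟨(l w - l a - 1) / (φ a - c), ?_⟩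
    have : φ a - c ≠ 0 := by linarith
    simp only [add_apply, smul_apply, smul_eq_mul,
      hφ w hw.1]
    have : (l w - l a - 1) / (φ a - c) * (φ a - c) = l w - l a - 1 := by field_simp
    linarith
  have hle : ∀ r ∈ R, (l + τ • φ) r ≤ (l + τ • φ) w := by
    intro r hr
    simpa [hφ r hr, hφ w hw.1] using hw.2 r hr
  refine ⟨l + τ • φ, Subset.antisymm ?_ ?_⟩
  · rintro x ⟨hx, hx2⟩
    refine ⟨subset_pyr hx, fun y hy => ?_⟩
    have hxw : (l + τ • φ) w ≤ (l + τ • φ) x := by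
      simpa [hφ x hx, hφ w hw.1] using hx2 w hw.1
    rcases (mem_pyr hR).1 hy with rfl | ⟨r, hr, t, h0, h1, rfl⟩
    · linarith
    · have := hle r hr
      rw [map_pyr]
      nlinarith
  · rintro x ⟨hx, hx2⟩
    have hxw := hx2 w (subset_pyr hw.1)
    rcases (mem_pyr hR).1 hx with rfl | ⟨r, hr, t, h0, h1, rfl⟩
    · linarith
    · have := hle r hr
      rw [map_pyr] at hxw
      have h6 : t = 1 := by nlinarith
      subst h6
      have h7 : a + (1 : ℝ) • (r - a) = r := by simp
      rw [h7] at hx2 ⊢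
      refine ⟨hr, fun y hy => ?_⟩
      simpa [hφ r hr, hφ y hy] using hx2 y (subset_pyr hy)

theorem face_one {R F : Set E} (hR : Convex ℝ R) {a : E} {φ : StrongDual ℝ E} {c : ℝ}
    (hφ : ∀ x ∈ R, φ x = c) (ha : c < φ a) (h : IsExposed ℝ R F) :
    IsExposed ℝ (convexHull ℝ (insert a R)) (convexHull ℝ (insert a F)) := by
  intro _
  have hcF : Convex ℝ F := h.convex hR
  obtain ⟨l, hl1, hl2⟩ : ∃ l : StrongDual ℝ E, (∀ r ∈ R, l r ≤ l a) ∧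
      ∀ r ∈ R, (r ∈ F ↔ l r = l a) := by
    rcases F.eq_empty_or_nonempty with rfl | ⟨w, hw⟩
    · refine ⟨φ, fun r hr => by rw [hφ r hr]; exact ha.le, fun r hr => ?_⟩
      rw [hφ r hr]
      simp [ha.ne]
    · obtain ⟨l, rfl⟩ := h ⟨w, hw⟩
      obtain ⟨τ, hτ⟩ : ∃ τ : ℝ, (l + τ • φ) a = (l + τ • φ) w := by
        refine ⟨(l w - l a) / (φ a - c), ?_⟩
        have : φ a - c ≠ 0 := by linarith
        simp only [add_apply, smul_apply, smul_eq_mul,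
          hφ w hw.1]
        have : (l w - l a) / (φ a - c) * (φ a - c) = l w - l a := by field_simp
        linarith
      refine ⟨l + τ • φ, fun r hr => ?_, fun r hr => ?_⟩
      · rw [hτ]
        simpa [hφ r hr, hφ w hw.1] using hw.2 r hr
      · rw [hτ]
        simp only [add_apply, smul_apply, smul_eq_mul,
          hφ w hw.1, hφ r hr, add_left_inj]
        constructor
        · intro hr'
          exact le_antisymm (hw.2 r hr) (hr'.2 w hw.1)
        · intro he
          exact ⟨hr, fun y hy => by rw [he]; exact hw.2 y hy⟩
  have hle : ∀ y ∈ convexHull ℝ (insert a R), l y ≤ l a := by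
    intro y hy
    rcases (mem_pyr hR).1 hy with rfl | ⟨r, hr, t, h0, h1, rfl⟩
    · exact le_rfl
    · have := hl1 r hr
      rw [map_pyr]
      nlinarith
  refine ⟨l, Subset.antisymm ?_ ?_⟩
  · intro x hx
    refine ⟨convexHull_mono (insert_subset_insert h.subset) hx, fun y hy => ?_⟩
    have : l x = l a := by
      rcases (mem_pyr hcF).1 hx with rfl | ⟨r, hr, t, h0, h1, rfl⟩
      · rfl
      · rw [map_pyr, (hl2 r (h.subset hr)).1 hr]; simp
    rw [this]; exact hle y hy
  · rintro x ⟨hx, hx2⟩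
    apply (mem_pyr hcF).2
    rcases (mem_pyr hR).1 hx with rfl | ⟨r, hr, t, h0, h1, rfl⟩
    · left; rfl
    · right
      refine ⟨r, (hl2 r hr).2 ?_, t, h0, h1, rfl⟩
      have h2 := hx2 a apex_mem
      have h3 := hl1 r hr
      rw [map_pyr] at h2
      have h5 : 0 ≤ l r - l a := nonneg_of_mul_nonneg_right (by linarith) h0
      linarith

theorem fd_pyr {F : Set E} (hF : FiniteDimensional ℝ (affineSpan ℝ F).direction) (a : E) :
    FiniteDimensional ℝ (affineSpan ℝ (convexHull ℝ (insert a F))).direction := by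
  rw [affineSpan_convexHull]
  rw [direction_affineSpan] at hF ⊢
  infer_instance

theorem rk_pyr {F : Set E} (hF : FiniteDimensional ℝ (affineSpan ℝ F).direction) {a : E}
    (ha : a ∉ affineSpan ℝ F) : rk (convexHull ℝ (insert a F)) = rk F + 1 := by
  rcases F.eq_empty_or_nonempty with rfl | ⟨w, hw⟩
  · rw [rk_of_nonempty ⟨a, apex_mem⟩]
    rw [insert_empty_eq, convexHull_singleton]
    simp [pdim, rk_empty, direction_affineSpan]
  · rw [rk_of_nonempty ⟨a, apex_mem⟩, rk_of_nonempty ⟨w, hw⟩]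
    unfold pdim
    rw [affineSpan_convexHull, ← affineSpan_insert_affineSpan]
    rw [AffineSubspace.direction_affineSpan_insert (subset_affineSpan ℝ F hw)]
    have hne : a - w ∉ (affineSpan ℝ F).direction := by
      intro h
      apply ha
      have := AffineSubspace.vadd_mem_of_mem_direction h (subset_affineSpan ℝ F hw)
      simpa using this
    have h1 := Submodule.finrank_sup_add_finrank_inf_eq (Submodule.span ℝ {a -ᵥ w})
      (affineSpan ℝ F).direction
    have h2 : Submodule.span ℝ {a -ᵥ w} ⊓ (affineSpan ℝ F).direction = ⊥ := by
      rw [← disjoint_iff, disjoint_comm]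
      refine (Submodule.disjoint_span_singleton' ?_).2 hne
      intro h0
      apply hne
      rw [vsub_eq_sub] at h0
      rw [h0]; exact Submodule.zero_mem _
    rw [h2, finrank_bot, finrank_span_singleton] at h1
    · omega
    · intro h0
      apply hne
      rw [vsub_eq_sub] at h0
      rw [h0]; exact Submodule.zero_mem _

/-- multichains of faces with prescribed ranks -/
def chains (P : Set E) (b : ℕ → ℕ) : Set (ℕ → Set E) :=
  {c | (∀ i, IsExposed ℝ P (c i) ∧ rk (c i) = ∑ j ∈ Finset.range (i + 1), b j) ∧ Monotone c}

/-- counting formula for multichains -/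
def Good (P : Set E) (N : ℕ) (x y : ℚ) : Prop :=
  Convex ℝ P ∧ FiniteDimensional ℝ (affineSpan ℝ P).direction ∧ rk P = N ∧
    ∀ (n : ℕ) (b : ℕ → ℕ), (∀ i, n ≤ i → b i = 0) → ∑ j ∈ Finset.range n, b j = N →
      (chains P b).Finite ∧
      ((chains P b).ncard : ℚ) * ∏ j ∈ Finset.range n, ((b j).factorial : ℚ) =
        x - y * ∑ j ∈ Finset.range n, (b j : ℚ) * ((b j : ℚ) - 1) * ((b j : ℚ) - 2)

theorem psum_update (b : ℕ → ℕ) (k : ℕ) (hk : 1 ≤ b k) (n : ℕ) :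
    ∑ j ∈ Finset.range n, b j =
      ∑ j ∈ Finset.range n, Function.update b k (b k - 1) j + (if k < n then 1 else 0) := by
  induction n with
  | zero => simp
  | succ n ih =>
    rw [Finset.sum_range_succ, Finset.sum_range_succ, ih]
    by_cases h : n = k
    · subst h
      simp
      omega
    · rw [Function.update_of_ne h]
      split_ifs <;> omega

theorem ncard_biUnion_aux {α : Type*} (n : ℕ) (X : ℕ → Set α) (hf : ∀ k < n, (X k).Finite)
    (hd : ∀ k l, k ≠ l → Disjoint (X k) (X l)) :
    (⋃ k ∈ Finset.range n, X k).Finite ∧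
    (⋃ k ∈ Finset.range n, X k).ncard = ∑ k ∈ Finset.range n, (X k).ncard := by
  induction n with
  | zero => simp
  | succ n ih =>
    obtain ⟨h1, h2⟩ := ih (fun k hk => hf k (by omega))
    have he : (⋃ k ∈ Finset.range (n + 1), X k) = (⋃ k ∈ Finset.range n, X k) ∪ X n := by
      rw [Finset.range_add_one, Finset.set_biUnion_insert, union_comm]
    have hn := hf n (by omega)
    refine ⟨by rw [he]; exact h1.union hn, ?_⟩
    rw [he, ncard_union_eq _ h1 hn, h2, Finset.sum_range_succ]
    simp only [disjoint_iUnion_left]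
    intro k hk
    apply hd
    simp at hk; omega

open Classical in
theorem rk_face {R G : Set E} (hR : Convex ℝ R)
    (hfd : FiniteDimensional ℝ (affineSpan ℝ R).direction) {a : E} (ha : a ∉ affineSpan ℝ R)
    (h : IsExposed ℝ (convexHull ℝ (insert a R)) G) :
    rk G = rk (G ∩ R) + if a ∈ G then 1 else 0 := by
  obtain ⟨h1, h2⟩ := face_eq hR h
  by_cases haG : a ∈ G
  · rw [if_pos haG]
    conv_lhs => rw [h2 haG]
    apply rk_pyr (fd_mono inter_subset_right hfd)
    exact fun h => ha (affineSpan_mono ℝ inter_subset_right h)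
  · rw [if_neg haG, inter_eq_left.2 (h1 haG), add_zero]

open Classical in
theorem good_pyr {R : Set E} {N : ℕ} {x y : ℚ} (h : Good R N x y) {a : E}
    (ha : a ∉ affineSpan ℝ R) :
    Good (convexHull ℝ (insert a R)) (N + 1) ((N + 1) * x) ((N - 2) * y) := by
  obtain ⟨hR, hfd, hrk, hcount⟩ := h
  refine ⟨convex_convexHull ℝ _, fd_pyr hfd a, by rw [rk_pyr hfd ha, hrk], ?_⟩
  intro n b hb hsum
  obtain ⟨φ, c0, hφ, hφa⟩ := exists_phi hfd ha
  have haR : a ∉ R := fun h => ha (subset_affineSpan ℝ R h)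
  set Q := convexHull ℝ (insert a R) with hQ
  let X : ℕ → Set (ℕ → Set E) := fun k => {c ∈ chains Q b | ∀ i, a ∈ c i ↔ k ≤ i}
  have hX0 : ∀ k, b k = 0 → X k = ∅ := by
    intro k hk
    rw [eq_empty_iff_forall_notMem]
    rintro c ⟨⟨hc, hm⟩, hck⟩
    have h1 := rk_face hR hfd ha (hc k).1
    rw [if_pos ((hck k).2 le_rfl), (hc k).2] at h1
    cases k with
    | zero => simp [hk] at h1
    | succ k =>
      have h2 := rk_face hR hfd ha (hc k).1
      rw [if_neg (by rw [hck k]; omega), (hc k).2] at h2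
      rw [Finset.sum_range_succ, hk] at h1
      have h3 : rk (c k ∩ R) ≤ rk (c (k + 1) ∩ R) :=
        rk_mono (inter_subset_inter_left R (hm (Nat.le_succ k))) (fd_mono inter_subset_right hfd)
      omega
  have hX1 : ∀ k, 1 ≤ b k → ∃ Ψ : (ℕ → Set E) → (ℕ → Set E),
      InjOn Ψ (chains R (Function.update b k (b k - 1))) ∧
      X k = Ψ '' (chains R (Function.update b k (b k - 1))) := by
    intro k hk
    let Ψ : (ℕ → Set E) → (ℕ → Set E) := fun c i =>
      if k ≤ i then convexHull ℝ (insert a (c i)) else c i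
    have hinv : ∀ c, (∀ i, IsExposed ℝ R (c i)) → ∀ i, Ψ c i ∩ R = c i := by
      intro c hc i
      simp only [Ψ]
      split_ifs
      · exact inter_one ((hc i).convex hR) (hc i).subset hφ hφa
      · exact inter_eq_left.2 (hc i).subset
    have hps : ∀ i, ∑ j ∈ Finset.range (i + 1), b j =
      ∑ j ∈ Finset.range (i + 1), Function.update b k (b k - 1) j + (if k ≤ i then 1 else 0) := by
      intro i
      rw [psum_update b k hk (i + 1)]
      congr 1
      simp
    refine ⟨Ψ, ?_, ?_⟩
    · intro c hc c' hc' he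
      funext i
      rw [← hinv c (fun i => (hc.1 i).1) i, ← hinv c' (fun i => (hc'.1 i).1) i, he]
    · apply Subset.antisymm
      · rintro c ⟨⟨hc, hm⟩, hck⟩
        refine ⟨fun i => c i ∩ R, ⟨fun i => ⟨face_inter subset_pyr (hc i).1, ?_⟩, ?_⟩, ?_⟩
        · have h1 := rk_face hR hfd ha (hc i).1
          rw [(hc i).2, hps i] at h1
          simp only [hck i] at h1
          change rk (c i ∩ R) = _
          omega
        · intro i j hij
          exact inter_subset_inter_left R (hm hij)
        · funext i
          obtain ⟨h1, h2⟩ := face_eq hR (hc i).1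
          simp only [Ψ]
          split_ifs with hki
          · exact (h2 ((hck i).2 hki)).symm
          · exact inter_eq_left.2 (h1 (fun h => hki ((hck i).1 h)))
      · rintro _ ⟨c, ⟨hc, hm⟩, rfl⟩
        have hexp : ∀ i, IsExposed ℝ Q (Ψ c i) := by
          intro i
          simp only [Ψ]
          split_ifs
          · exact face_one hR hφ hφa (hc i).1
          · exact face_zero hR hφ hφa (hc i).1
        have hmem : ∀ i, a ∈ Ψ c i ↔ k ≤ i := by
          intro i
          simp only [Ψ]
          split_ifs with hki
          · simp [hki, apex_mem]
          · simp only [hki, iff_false]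
            exact fun h => haR ((hc i).1.subset h)
        refine ⟨⟨fun i => ⟨hexp i, ?_⟩, ?_⟩, hmem⟩
        · rw [rk_face hR hfd ha (hexp i), hinv c (fun i => (hc i).1) i, (hc i).2, hps i]
          simp only [hmem i]
        · intro i j hij
          simp only [Ψ]
          split_ifs
          · exact convexHull_mono (insert_subset_insert (hm hij))
          · omega
          · exact (hm hij).trans subset_pyr
          · exact hm hij
  have hXf : ∀ k < n, (X k).Finite ∧
      ((X k).ncard : ℚ) * ∏ j ∈ Finset.range n, ((b j).factorial : ℚ) =
        b k * (x - y * (∑ j ∈ Finset.range n, (b j : ℚ) * ((b j : ℚ) - 1) * ((b j : ℚ) - 2)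
          - 3 * ((b k : ℚ) - 1) * ((b k : ℚ) - 2))) := by
    intro k hkn
    rcases Nat.eq_zero_or_pos (b k) with h0 | h0
    · rw [hX0 k h0, h0]; simp
    · obtain ⟨Ψ, hi, he⟩ := hX1 k h0
      obtain ⟨hf, hc⟩ := hcount n (Function.update b k (b k - 1))
        (by
          intro i hi
          rw [Function.update_of_ne (by omega)]
          exact hb i hi)
        (by
          have := psum_update b k h0 n
          rw [if_pos hkn, hsum] at this
          omega)
      rw [he]
      refine ⟨hf.image Ψ, ?_⟩
      rw [hi.ncard_image]
      have hkm : k ∈ Finset.range n := by simpa using hkn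
      have hprod : ∏ j ∈ Finset.range n, ((b j).factorial : ℚ) =
          b k * ∏ j ∈ Finset.range n, ((Function.update b k (b k - 1) j).factorial : ℚ) := by
        rw [← Finset.mul_prod_erase _ _ hkm, ← Finset.mul_prod_erase _ (fun j =>
          ((Function.update b k (b k - 1) j).factorial : ℚ)) hkm, ← mul_assoc]
        congr 1
        · rw [Function.update_self]
          exact_mod_cast (Nat.mul_factorial_pred (by omega)).symm
        · apply Finset.prod_congr rfl
          intro j hj
          rw [Function.update_of_ne (Finset.ne_of_mem_erase hj)]
      have hs3 : ∑ j ∈ Finset.range n, (Function.update b k (b k - 1) j : ℚ) *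
          ((Function.update b k (b k - 1) j : ℚ) - 1) * ((Function.update b k (b k - 1) j : ℚ) - 2) =
          (∑ j ∈ Finset.range n, (b j : ℚ) * ((b j : ℚ) - 1) * ((b j : ℚ) - 2)
          - 3 * ((b k : ℚ) - 1) * ((b k : ℚ) - 2)) := by
        rw [← Finset.add_sum_erase _ _ hkm, ← Finset.add_sum_erase _ (fun j =>
          (b j : ℚ) * ((b j : ℚ) - 1) * ((b j : ℚ) - 2)) hkm]
        have : ∀ j ∈ (Finset.range n).erase k, (Function.update b k (b k - 1) j : ℚ) *
          ((Function.update b k (b k - 1) j : ℚ) - 1) * ((Function.update b k (b k - 1) j : ℚ) - 2)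
            = (b j : ℚ) * ((b j : ℚ) - 1) * ((b j : ℚ) - 2) := by
          intro j hj
          rw [Function.update_of_ne (Finset.ne_of_mem_erase hj)]
        rw [Finset.sum_congr rfl this, Function.update_self, Nat.cast_sub h0]
        push_cast
        ring
      rw [hprod, ← hs3, ← hc]
      ring
  have hcover : chains Q b = ⋃ k ∈ Finset.range n, X k := by
    apply Subset.antisymm
    · intro c hc
      have hex : ∃ i, a ∈ c i := by
        refine ⟨n, ?_⟩
        by_contra hna
        have h1 := rk_face hR hfd ha (hc.1 n).1
        rw [if_neg hna, (hc.1 n).2, Finset.sum_range_succ, hsum, hb n le_rfl] at h1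
        have h2 := rk_mono (inter_subset_right : c n ∩ R ⊆ R) hfd
        omega
      have hmemX : c ∈ X (Nat.find hex) := by
        refine ⟨hc, fun i => ⟨fun h => Nat.find_min' hex h, fun h => ?_⟩⟩
        exact hc.2 h (Nat.find_spec hex)
      simp only [mem_iUnion]
      refine ⟨Nat.find hex, ?_, hmemX⟩
      by_contra hlt
      rw [Finset.mem_range, not_lt] at hlt
      rw [hX0 _ (hb _ hlt)] at hmemX
      exact hmemX
    · simp only [iUnion_subset_iff]
      intro k _ c hc
      exact hc.1
  have hdisj : ∀ k l, k ≠ l → Disjoint (X k) (X l) := by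
    intro k l hkl
    rw [Set.disjoint_left]
    rintro c ⟨_, h1⟩ ⟨_, h2⟩
    have h3 := (h2 k).1 ((h1 k).2 le_rfl)
    have h4 := (h1 l).1 ((h2 l).2 le_rfl)
    omega
  obtain ⟨hfin, hcard⟩ := ncard_biUnion_aux n X (fun k hk => (hXf k hk).1) hdisj
  rw [hcover]
  refine ⟨hfin, ?_⟩
  rw [hcard]
  push_cast
  rw [Finset.sum_mul, Finset.sum_congr rfl (fun k hk => (hXf k (by simpa using hk)).2)]
  have hsumQ : ∑ j ∈ Finset.range n, (b j : ℚ) = N + 1 := by exact_mod_cast hsum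
  set S3 := ∑ j ∈ Finset.range n, (b j : ℚ) * ((b j : ℚ) - 1) * ((b j : ℚ) - 2) with hS3
  have : ∀ k ∈ Finset.range n, (b k : ℚ) * (x - y * (S3 - 3 * ((b k : ℚ) - 1) * ((b k : ℚ) - 2)))
      = (b k : ℚ) * (x - y * S3) + 3 * y * ((b k : ℚ) * ((b k : ℚ) - 1) * ((b k : ℚ) - 2)) := by
    intro k _
    ring
  rw [Finset.sum_congr rfl this, Finset.sum_add_distrib, ← Finset.sum_mul, ← Finset.mul_sum, hsumQ,
    ← hS3]
  ring

theorem good_empty : Good (∅ : Set E) 0 1 0 := by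
  refine ⟨convex_empty, ?_, rk_empty, ?_⟩
  · rw [AffineSubspace.span_empty, AffineSubspace.direction_bot]
    infer_instance
  · intro n b hb hs
    have hz : ∀ j, b j = 0 := by
      intro j
      rcases lt_or_ge j n with h | h
      · exact (Finset.sum_eq_zero_iff.1 hs) j (by simpa using h)
      · exact hb j h
    have : chains (∅ : Set E) b = {fun _ => ∅} := by
      apply Subset.antisymm
      · intro c hc
        simp only [mem_singleton_iff]
        funext i
        exact subset_empty_iff.1 (hc.1 i).1.subset
      · rintro _ rfl
        refine ⟨fun i => ⟨isExposed_empty, ?_⟩, fun _ _ _ => le_rfl⟩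
        simp [rk_empty, hz]
    rw [this]
    simp [hz]

theorem poly_face {v : Finset E} {B F : Set E} (hB : B = convexHull ℝ (v : Set E))
    (hext : B.extremePoints ℝ = (v : Set E)) (h : IsExposed ℝ B F) :
    F = convexHull ℝ ((v : Set E) ∩ F) := by
  have hBc : IsCompact B := by rw [hB]; exact v.finite_toSet.isCompact_convexHull ℝ
  have hBcv : Convex ℝ B := by rw [hB]; exact convex_convexHull ℝ _
  have h1 := closure_convexHull_extremePoints (h.isCompact hBc) (h.convex hBcv)
  rw [h.isExtreme.extremePoints_eq, hext] at h1
  have hfin : ((F : Set E) ∩ (v : Set E)).Finite := v.finite_toSet.inter_of_right F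
  rw [(hfin.isCompact_convexHull ℝ).isClosed.closure_eq] at h1
  rw [inter_comm]
  exact h1.symm

theorem poly_fd {v : Finset E} {B : Set E} (hB : B = convexHull ℝ (v : Set E)) :
    FiniteDimensional ℝ (affineSpan ℝ B).direction := by
  rw [hB, affineSpan_convexHull]
  exact finiteDimensional_direction_affineSpan_of_finite ℝ v.finite_toSet

theorem rk_singleton (x : E) : rk ({x} : Set E) = 1 := by
  rw [rk_of_nonempty (singleton_nonempty x)]
  simp [pdim, direction_affineSpan]

theorem rk_pair {x y : E} (h : x ≠ y) : rk (convexHull ℝ ({x, y} : Set E)) = 2 := by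
  rw [rk_pyr, rk_singleton]
  · exact finiteDimensional_direction_affineSpan_of_finite ℝ (finite_singleton y)
  · rw [AffineSubspace.mem_affineSpan_singleton]; exact h

theorem rk_one_singleton {F : Set E} (hfd : FiniteDimensional ℝ (affineSpan ℝ F).direction)
    (h : rk F = 1) : ∃ x, F = {x} := by
  have hne : F.Nonempty := by
    rw [nonempty_iff_ne_empty]; intro h0
    rw [h0, rk_empty] at h; omega
  rw [rk_of_nonempty hne] at h
  have h0 : Module.finrank ℝ (affineSpan ℝ F).direction = 0 := by
    unfold pdim at h; omega
  rw [Submodule.finrank_eq_zero, direction_affineSpan, vectorSpan_eq_bot_iff_subsingleton] at h0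
  obtain ⟨x, hx⟩ := hne
  exact ⟨x, h0.eq_singleton_of_mem hx⟩

theorem vertex_functional {v : Finset E} {B : Set E} (hB : B = convexHull ℝ (v : Set E))
    (hext : B.extremePoints ℝ = (v : Set E)) {x : E} (hx : x ∈ v) :
    ∃ l : StrongDual ℝ E, ∀ y ∈ v, y ≠ x → l y < l x := by
  have hnm : x ∉ convexHull ℝ ((v : Set E) \ {x}) := by
    intro h
    have h1 : B = convexHull ℝ ((v : Set E) \ {x}) := by
      rw [hB]
      apply Subset.antisymm
      · apply convexHull_min _ (convex_convexHull ℝ _)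
        intro y hy
        by_cases hyx : y = x
        · rw [hyx]; exact h
        · exact subset_convexHull ℝ _ ⟨hy, hyx⟩
      · exact convexHull_mono sdiff_subset
    have h2 : x ∈ B.extremePoints ℝ := by rw [hext]; exact hx
    rw [h1] at h2
    exact (extremePoints_convexHull_subset h2).2 rfl
  obtain ⟨l, u, h1, h2⟩ := geometric_hahn_banach_closed_point (convex_convexHull ℝ _)
    (v.finite_toSet.sdiff.isCompact_convexHull ℝ).isClosed hnm
  refine ⟨l, fun y hy hyx => ?_⟩
  exact (h1 y (subset_convexHull ℝ _ ⟨hy, hyx⟩)).trans h2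

/-- the face exposed by a functional maximal on `W` -/
theorem face_of_functional {v : Finset E} {B : Set E} (hB : B = convexHull ℝ (v : Set E))
    (hext : B.extremePoints ℝ = (v : Set E)) (h : StrongDual ℝ E) {W : Set E} {x : E}
    (hx : x ∈ W) (hW : W ⊆ v) (h1 : ∀ z ∈ W, h z = h x) (h2 : ∀ z ∈ v, z ∉ W → h z < h x) :
    IsExposed ℝ B (convexHull ℝ W) ∧ (v : Set E) ∩ convexHull ℝ W = W := by
  have hvB : (v : Set E) ⊆ B := by rw [hB]; exact subset_convexHull ℝ _
  have hle : ∀ y ∈ B, h y ≤ h x := by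
    intro y hy
    rw [hB] at hy
    have : convexHull ℝ (v : Set E) ⊆ {y | h y ≤ h x} := by
      apply convexHull_min
      · intro z hz
        by_cases hzW : z ∈ W
        · exact (h1 z hzW).le
        · exact (h2 z hz hzW).le
      · exact convex_halfSpace_le h.toLinearMap.isLinear (h x)
    exact this hy
  have hexp : IsExposed ℝ B {z ∈ B | ∀ y ∈ B, h y ≤ h z} := fun _ => ⟨h, rfl⟩
  have hvF : (v : Set E) ∩ {z ∈ B | ∀ y ∈ B, h y ≤ h z} = W := by
    apply Subset.antisymm
    · rintro z ⟨hz, hz1, hz2⟩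
      by_contra hzW
      exact absurd (hz2 x (hvB (hW hx))) (not_le.2 (h2 z hz hzW))
    · intro z hz
      refine ⟨hW hz, hvB (hW hz), fun y hy => ?_⟩
      rw [h1 z hz]; exact hle y hy
  have hpf := poly_face hB hext hexp
  rw [hvF] at hpf
  rw [hpf] at hexp hvF
  exact ⟨hexp, hvF⟩

theorem vertex_faces {v : Finset E} {B : Set E} (hB : B = convexHull ℝ (v : Set E))
    (hext : B.extremePoints ℝ = (v : Set E)) (F : Set E) :
    (IsExposed ℝ B F ∧ rk F = 1) ↔ ∃ x ∈ v, F = {x} := by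
  constructor
  · rintro ⟨h, hr⟩
    obtain ⟨x, rfl⟩ := rk_one_singleton (fd_mono h.subset (poly_fd hB)) hr
    refine ⟨x, ?_, rfl⟩
    have := isExtreme_singleton.1 h.isExtreme
    rw [hext] at this
    exact this
  · rintro ⟨x, hx, rfl⟩
    obtain ⟨l, hl⟩ := vertex_functional hB hext hx
    have := (face_of_functional hB hext l (W := {x}) (x := x) rfl (by simpa using hx)
      (by simp) (fun z hz hzx => hl z hz hzx)).1
    rw [convexHull_singleton] at this
    exact ⟨this, rk_singleton x⟩

theorem no_between {v : Finset E} {B : Set E} (hB : B = convexHull ℝ (v : Set E))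
    (hext : B.extremePoints ℝ = (v : Set E)) {x y z : E} (hx : x ∈ v) (hy : y ∈ v) (hz : z ∈ v)
    (h : y ∈ segment ℝ x z) : x = y ∨ z = y := by
  have hvB : (v : Set E) ⊆ B := by rw [hB]; exact subset_convexHull ℝ _
  have h1 : y ∈ B.extremePoints ℝ := by rw [hext]; exact hy
  exact (mem_extremePoints_iff_forall_segment.1 h1).2 x (hvB hx) z (hvB hz) h

theorem edge_pair {v : Finset E} {B : Set E} (hB : B = convexHull ℝ (v : Set E))
    (hext : B.extremePoints ℝ = (v : Set E)) {F : Set E} (h : IsExposed ℝ B F) (hr : rk F = 2) :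
    ∃ x ∈ v, ∃ y ∈ v, x ≠ y ∧ (v : Set E) ∩ F = {x, y} := by
  have hpf := poly_face hB hext h
  have hne : F.Nonempty := by
    rw [nonempty_iff_ne_empty]; intro h0
    rw [h0, rk_empty] at hr; omega
  have hnt : ((v : Set E) ∩ F).Nontrivial := by
    by_contra hs
    rw [not_nontrivial_iff] at hs
    rcases hs.eq_empty_or_singleton with h0 | ⟨x, hx⟩
    · rw [h0, convexHull_empty] at hpf
      exact hne.ne_empty hpf
    · rw [hx, convexHull_singleton] at hpf
      rw [hpf, rk_singleton] at hr
      omega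
  obtain ⟨x, hx, y, hy, hxy⟩ := hnt
  refine ⟨x, hx.1, y, hy.1, hxy, Subset.antisymm ?_ ?_⟩
  · intro z hz
    by_contra hzn
    simp only [mem_insert_iff, mem_singleton_iff, not_or] at hzn
    have hfd := fd_mono h.subset (poly_fd hB)
    rw [rk_of_nonempty hne] at hr
    have hcol : Collinear ℝ F := by
      rw [direction_affineSpan] at hfd
      rw [collinear_iff_finrank_le_one, ← direction_affineSpan]
      unfold pdim at hr
      omega
    have hcol3 : Collinear ℝ {x, y, z} := by
      apply hcol.subset
      rintro w (rfl | rfl | rfl)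
      exacts [hx.2, hy.2, hz.2]
    rcases hcol3.wbtw_or_wbtw_or_wbtw with hw | hw | hw
    · rcases no_between hB hext hx.1 hy.1 hz.1 (mem_segment_iff_wbtw.2 hw) with e | e
      · exact hxy e
      · exact hzn.2 e
    · rcases no_between hB hext hy.1 hz.1 hx.1 (mem_segment_iff_wbtw.2 hw) with e | e
      · exact hzn.2 e.symm
      · exact hzn.1 e.symm
    · rcases no_between hB hext hz.1 hx.1 hy.1 (mem_segment_iff_wbtw.2 hw) with e | e
      · exact hzn.1 e
      · exact hxy e.symm
  · rintro w (rfl | rfl)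
    exacts [hx, hy]

/-- in a plane, a nonzero functional is completed to a basis of the dual -/
theorem exists_second {D : Submodule ℝ E} (hD : Module.finrank ℝ D = 2) (l : StrongDual ℝ E)
    (hl : ∃ u ∈ D, l u ≠ 0) :
    ∃ g : StrongDual ℝ E, ∀ h : StrongDual ℝ E, ∃ α β : ℝ, ∀ u ∈ D, h u = α * l u + β * g u := by
  have : FiniteDimensional ℝ D := FiniteDimensional.of_finrank_pos (by omega)
  let b : Module.Basis (Fin 2) ℝ D := Module.finBasisOfFinrankEq ℝ D hD
  have hrep : ∀ u ∈ D, ∃ s t : ℝ, u = s • (b 0 : E) + t • (b 1 : E) := by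
    intro u hu
    have := b.sum_repr ⟨u, hu⟩
    rw [Fin.sum_univ_two] at this
    exact ⟨_, _, (congrArg Subtype.val this).symm⟩
  set p := l (b 0 : E) with hp
  set q := l (b 1 : E) with hq
  have hne : q • (b 0 : E) - p • (b 1 : E) ≠ 0 := by
    intro h0
    have h1 : q • b 0 + (-p) • b 1 = 0 := by
      apply Subtype.ext
      simpa [sub_eq_add_neg] using h0
    have h2 := (Fintype.linearIndependent_iff.1 b.linearIndependent) ![q, -p]
      (by simpa [Fin.sum_univ_two] using h1)
    have hq0 : q = 0 := h2 0
    have hp0 : p = 0 := by simpa using h2 1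
    obtain ⟨u, hu, hlu⟩ := hl
    obtain ⟨s, t, rfl⟩ := hrep u hu
    apply hlu
    rw [map_add, map_smul, map_smul, ← hp, ← hq, hp0, hq0]
    simp
  obtain ⟨g, hg⟩ := SeparatingDual.exists_eq_one (R := ℝ) hne
  rw [map_sub, map_smul, map_smul, smul_eq_mul, smul_eq_mul] at hg
  refine ⟨g, fun h => ⟨h (b 1 : E) * g (b 0 : E) - h (b 0 : E) * g (b 1 : E),
    q * h (b 0 : E) - p * h (b 1 : E), fun u hu => ?_⟩⟩
  obtain ⟨s, t, rfl⟩ := hrep u hu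
  simp only [map_add, map_smul, smul_eq_mul, ← hp, ← hq]
  linear_combination (-(s * h (b 0 : E)) - t * h (b 1 : E)) * hg

theorem vertex_edges {v : Finset E} {B : Set E} (hB : B = convexHull ℝ (v : Set E))
    (hext : B.extremePoints ℝ = (v : Set E)) (hdim : pdim B = 2) (hcard : 3 ≤ v.card)
    {x : E} (hx : x ∈ v) :
    ∃ F1 F2 : Set E, F1 ≠ F2 ∧ {F | (IsExposed ℝ B F ∧ rk F = 2) ∧ x ∈ F} = {F1, F2} := by
  classical
  have hvB : (v : Set E) ⊆ B := by rw [hB]; exact subset_convexHull ℝ _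
  have hdir : ∀ y ∈ B, ∀ z ∈ B, y - z ∈ (affineSpan ℝ B).direction := fun y hy z hz =>
    AffineSubspace.vsub_mem_direction (subset_affineSpan ℝ B hy) (subset_affineSpan ℝ B hz)
  obtain ⟨l, hl⟩ := vertex_functional hB hext hx
  set O := v.erase x with hO
  have hOc : 1 < O.card := by rw [hO, Finset.card_erase_of_mem hx]; omega
  have hOne : O.Nonempty := Finset.card_pos.1 (by omega)
  have hOv : ∀ y ∈ O, y ∈ v ∧ y ≠ x := fun y hy =>
    ⟨Finset.mem_of_mem_erase hy, Finset.ne_of_mem_erase hy⟩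
  have hL : ∀ y ∈ O, 0 < l x - l y := fun y hy => by
    have := hl y (hOv y hy).1 (hOv y hy).2
    linarith
  obtain ⟨g, hg⟩ := exists_second (D := (affineSpan ℝ B).direction) hdim l (by
    obtain ⟨y, hy⟩ := hOne
    refine ⟨x - y, hdir x (hvB hx) y (hvB (hOv y hy).1), ?_⟩
    rw [map_sub]
    exact (hL y hy).ne')
  let σ : E → ℝ := fun y => (g y - g x) / (l x - l y)
  have hσ : ∀ y ∈ O, g y - g x = σ y * (l x - l y) := fun y hy => by
    have := (hL y hy).ne'
    simp only [σ]
    field_simp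
  have hσinj : ∀ y ∈ O, ∀ z ∈ O, σ y = σ z → y = z := by
    have key : ∀ y ∈ O, ∀ z ∈ O, σ y = σ z → l x - l y ≤ l x - l z → y = z := by
      intro y hy z hz hyz hle
      have hLy := hL y hy
      have hLz := hL z hz
      have heq : y = x + ((l x - l y) / (l x - l z)) • (z - x) := by
        apply (SeparatingDual.eq_iff_forall_dual_eq (R := ℝ)).2
        intro h
        obtain ⟨α, β, hab⟩ := hg h
        have e1 := hab (y - x) (hdir y (hvB (hOv y hy).1) x (hvB hx))
        have e2 := hab (z - x) (hdir z (hvB (hOv z hz).1) x (hvB hx))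
        rw [map_sub, map_sub, map_sub, hσ y hy, hyz] at e1
        rw [map_sub, map_sub, map_sub, hσ z hz] at e2
        rw [map_pyr, e2]
        have : h y = h x + (α * (l y - l x) + β * (σ z * (l x - l y))) := by linarith
        rw [this]
        field_simp
        ring
      have hseg : y ∈ segment ℝ x z := by
        rw [segment_eq_image']
        exact ⟨_, ⟨by positivity, (div_le_one hLz).2 hle⟩, heq.symm⟩
      rcases no_between hB hext hx (hOv y hy).1 (hOv z hz).1 hseg with e | e
      · exact absurd e.symm (hOv y hy).2
      · exact e.symm
    intro y hy z hz hyz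
    rcases le_total (l x - l y) (l x - l z) with h | h
    · exact key y hy z hz hyz h
    · exact (key z hz y hy hyz.symm h).symm
  obtain ⟨y1, hy1, hmax⟩ := O.exists_max_image σ hOne
  obtain ⟨y2, hy2, hmin⟩ := O.exists_min_image σ hOne
  have hne : y1 ≠ y2 := by
    rintro rfl
    obtain ⟨a, ha, b, hb, hab⟩ := Finset.one_lt_card.1 hOc
    apply hab
    apply hσinj a ha b hb
    have := hmax a ha
    have := hmax b hb
    have := hmin a ha
    have := hmin b hb
    linarith
  have hedge : ∀ y0 ∈ O, ∀ ε : ℝ, (∀ z ∈ O, z ≠ y0 → ε * σ z < ε * σ y0) →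
      (IsExposed ℝ B (convexHull ℝ {x, y0}) ∧ rk (convexHull ℝ {x, y0}) = 2) ∧
      (v : Set E) ∩ convexHull ℝ {x, y0} = {x, y0} := by
    intro y0 hy0 ε hε
    have hval : ∀ z ∈ O, (ε • g + (ε * σ y0) • l) z - (ε • g + (ε * σ y0) • l) x =
        (ε * σ z - ε * σ y0) * (l x - l z) := by
      intro z hz
      simp only [add_apply, smul_apply, smul_eq_mul]
      linear_combination ε * hσ z hz
    have := face_of_functional hB hext (ε • g + (ε * σ y0) • l) (W := {x, y0}) (x := x)
      (by simp) (by
        rintro z (rfl | rfl)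
        exacts [hx, (hOv _ hy0).1])
      (by
        rintro z (rfl | rfl)
        · rfl
        · have := hval z hy0
          rw [sub_self, zero_mul] at this
          linarith)
      (by
        intro z hz hzn
        simp only [mem_insert_iff, mem_singleton_iff, not_or] at hzn
        have hzO : z ∈ O := Finset.mem_erase.2 ⟨hzn.1, hz⟩
        have h1 := hval z hzO
        have h2 := hε z hzO hzn.2
        have h3 := hL z hzO
        have h4 := mul_neg_of_neg_of_pos (sub_neg.2 h2) h3
        linarith)
    exact ⟨⟨this.1, rk_pair (hOv y0 hy0).2.symm⟩, this.2⟩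
  have he1 := hedge y1 hy1 1 (fun z hz hzn => by
    have h1 := hmax z hz
    have h2 : σ z ≠ σ y1 := fun h => hzn (hσinj z hz y1 hy1 h)
    simpa using lt_of_le_of_ne h1 h2)
  have he2 := hedge y2 hy2 (-1) (fun z hz hzn => by
    have h1 := hmin z hz
    have h2 : σ y2 ≠ σ z := fun h => hzn (hσinj y2 hy2 z hz h).symm
    have := lt_of_le_of_ne h1 h2
    linarith)
  refine ⟨convexHull ℝ {x, y1}, convexHull ℝ {x, y2}, ?_, Subset.antisymm ?_ ?_⟩
  · intro heq
    have h1 := he1.2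
    rw [heq, he2.2] at h1
    have : y2 ∈ ({x, y1} : Set E) := by rw [← h1]; simp
    rcases this with h | h
    · exact (hOv y2 hy2).2 h
    · exact hne h.symm
  · rintro F ⟨⟨hF, hr⟩, hxF⟩
    obtain ⟨p, hp, q, hq, hpq, hvF⟩ := edge_pair hB hext hF hr
    have hpf := poly_face hB hext hF
    obtain ⟨y, hyO, hvF'⟩ : ∃ y ∈ O, (v : Set E) ∩ F = {x, y} := by
      have : x ∈ ({p, q} : Set E) := by rw [← hvF]; exact ⟨hx, hxF⟩
      rcases this with h | h
      · exact ⟨q, Finset.mem_erase.2 ⟨by rw [h]; exact hpq.symm, hq⟩, by rw [h]; exact hvF⟩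
      · exact ⟨p, Finset.mem_erase.2 ⟨by rw [h]; exact hpq, hp⟩, by
          rw [h, Set.pair_comm]; exact hvF⟩
    rw [hvF'] at hpf
    have hyF : y ∈ F := by
      have : y ∈ (v : Set E) ∩ F := by rw [hvF']; simp
      exact this.2
    obtain ⟨h, hh⟩ := hF ⟨x, hxF⟩
    have hhx : ∀ z ∈ B, h z ≤ h x := by rw [hh] at hxF; exact hxF.2
    have hhy : h y = h x := by
      apply le_antisymm (hhx y (hvB (hOv y hyO).1))
      rw [hh] at hyF; exact hyF.2 x (hvB hx)
    obtain ⟨α, β, hab⟩ := hg h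
    have hval : ∀ z ∈ O, h z - h x = (β * σ z - α) * (l x - l z) := by
      intro z hz
      have e1 := hab (z - x) (hdir z (hvB (hOv z hz).1) x (hvB hx))
      rw [map_sub, map_sub, map_sub, hσ z hz] at e1
      rw [e1]; ring
    have hyval : β * σ y = α := by
      have h1 := hval y hyO
      rw [hhy, sub_self] at h1
      rcases mul_eq_zero.1 h1.symm with h2 | h2
      · linarith
      · exact absurd h2 (hL y hyO).ne'
    have hzval : ∀ z ∈ O, β * σ z ≤ β * σ y := by
      intro z hz
      have h1 := hval z hz
      have h2 := hhx z (hvB (hOv z hz).1)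
      have h3 : (β * σ z - α) * (l x - l z) ≤ 0 := by linarith
      have h4 := nonpos_of_mul_nonpos_left h3 (hL z hz)
      linarith
    rcases lt_trichotomy β 0 with hb | hb | hb
    · right
      have h1 : σ y ≤ σ y2 := by
        by_contra hlt
        exact absurd (hzval y2 hy2) (not_le.2 (mul_lt_mul_of_neg_left (not_le.1 hlt) hb))
      have h2 := hmin y hyO
      rw [hpf, hσinj y hyO y2 hy2 (le_antisymm h1 h2)]
      rfl
    · exfalso
      have hα : α = 0 := by rw [← hyval, hb, zero_mul]
      have hconst : ∀ z ∈ B, h z = h x := by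
        intro z hz
        have := hab (z - x) (hdir z hz x (hvB hx))
        rw [hα, hb, map_sub] at this
        linarith
      have hFB : F = B := by
        apply hF.subset.antisymm
        intro z hz
        rw [hh]
        exact ⟨hz, fun w hw => by rw [hconst z hz, hconst w hw]⟩
      rw [hFB, rk_of_nonempty ⟨x, hvB hx⟩, hdim] at hr
      omega
    · left
      have h1 : σ y1 ≤ σ y := le_of_mul_le_mul_left (hzval y1 hy1) hb
      have h2 := hmax y hyO
      rw [hpf, hσinj y hyO y1 hy1 (le_antisymm h2 h1)]
  · rintro F (rfl | rfl)
    · exact ⟨he1.1, subset_convexHull ℝ _ (by simp)⟩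
    · exact ⟨he2.1, subset_convexHull ℝ _ (by simp)⟩

theorem peel {b : ℕ → ℕ} {n k : ℕ} (hsum : ∑ j ∈ Finset.range n, b j = k + 1) :
    ∃ p < n, (∀ i < p, b i = 0) ∧ ∃ b' : ℕ → ℕ, (∀ i, b i = b' i + if i = p then 1 else 0) ∧
      ∑ j ∈ Finset.range n, b' j = k := by
  classical
  have hex : ∃ p, p < n ∧ b p ≠ 0 := by
    by_contra hcon
    push Not at hcon
    rw [Finset.sum_eq_zero (fun i hi => hcon i (Finset.mem_range.1 hi))] at hsum
    omega
  have hp := Nat.find_spec hex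
  refine ⟨Nat.find hex, hp.1, fun i hi => ?_, fun i => b i - if i = Nat.find hex then 1 else 0,
    fun i => ?_, ?_⟩
  · by_contra h0
    exact Nat.find_min hex hi ⟨hi.trans hp.1, h0⟩
  · by_cases h : i = Nat.find hex
    · have h2 := hp.2
      rw [← h] at h2
      simp only [h, if_true]
      rw [← h]
      omega
    · simp [h]
  · have hb : ∀ i, b i = (b i - if i = Nat.find hex then 1 else 0) +
        if i = Nat.find hex then 1 else 0 := by
      intro i
      by_cases h : i = Nat.find hex
      · have h2 := hp.2
        rw [← h] at h2
        simp only [h, if_true]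
        rw [← h]
        omega
      · simp [h]
    rw [Finset.sum_congr rfl (fun i _ => hb i), Finset.sum_add_distrib,
      Finset.sum_ite_eq', if_pos (Finset.mem_range.2 hp.1)] at hsum
    exact Nat.succ_injective hsum

theorem three_split {b : ℕ → ℕ} {n : ℕ} (hsum : ∑ j ∈ Finset.range n, b j = 3)
    (hz : ∀ i, n ≤ i → b i = 0) :
    ∃ p q r, p ≤ q ∧ q ≤ r ∧ r < n ∧
      (∀ i, b i = (if i = p then 1 else 0) + (if i = q then 1 else 0) + if i = r then 1 else 0) := by
  obtain ⟨p, hp, hp0, b1, hb1, hs1⟩ := peel hsum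
  obtain ⟨q, hq, hq0, b2, hb2, hs2⟩ := peel hs1
  obtain ⟨r, hr, hr0, b3, hb3, hs3⟩ := peel hs2
  refine ⟨p, q, r, ?_, ?_, hr, ?_⟩
  · by_contra h
    have h1 := hp0 q (by omega)
    have h2 := hb1 q
    have h3 := hb2 q
    simp only [if_true] at h3
    omega
  · by_contra h
    have h1 := hq0 r (by omega)
    have h2 := hb2 r
    have h3 := hb3 r
    simp only [if_true] at h3
    omega
  · intro i
    have h3 : b3 i = 0 := by
      by_cases hi : i < n
      · exact Finset.sum_eq_zero_iff.1 hs3 i (Finset.mem_range.2 hi)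
      · have h0 := hz i (by omega)
        have := hb1 i
        have := hb2 i
        have := hb3 i
        omega
    rw [hb1, hb2, hb3, h3]
    ring

theorem three_psum {b : ℕ → ℕ} {p q r : ℕ}
    (hb : ∀ i, b i = (if i = p then 1 else 0) + (if i = q then 1 else 0) + if i = r then 1 else 0)
    (i : ℕ) : ∑ j ∈ Finset.range (i + 1), b j =
      (if p ≤ i then 1 else 0) + (if q ≤ i then 1 else 0) + if r ≤ i then 1 else 0 := by
  simp only [hb, Finset.sum_add_distrib, Finset.sum_ite_eq', Finset.mem_range, Nat.lt_succ_iff]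

/-- two nested faces with the same rank coincide -/
theorem face_eq_of_rk {P F G : Set E} (hfd : FiniteDimensional ℝ (affineSpan ℝ P).direction)
    (hF : IsExposed ℝ P F) (hG : IsExposed ℝ P G) (hFG : F ⊆ G) (hr : rk F = rk G) : F = G :=
  face_full (fd_mono hG.subset hfd) (hF.mono hG.subset hFG) hr

def mkc (B : Set E) (p q r : ℕ) (w : Set E × Set E) (i : ℕ) : Set E :=
  if i < p then ∅ else if i < q then w.1 else if i < r then w.2 else B

def pairs (B : Set E) (p q r : ℕ) : Set (Set E × Set E) :=
  {w | IsExposed ℝ B w.1 ∧ IsExposed ℝ B w.2 ∧ rk w.1 = (if p < q then 1 else 0) ∧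
    rk w.2 = (if q < r then 2 else 3) ∧ w.1 ⊆ w.2}

theorem chains_eq {B : Set E} (hfd : FiniteDimensional ℝ (affineSpan ℝ B).direction)
    (hr3 : rk B = 3) {b : ℕ → ℕ} {p q r : ℕ} (hpq : p ≤ q) (hqr : q ≤ r)
    (hb : ∀ i, b i = (if i = p then 1 else 0) + (if i = q then 1 else 0) + if i = r then 1 else 0) :
    chains B b = mkc B p q r '' pairs B p q r := by
  apply Subset.antisymm
  · rintro c ⟨hc, hmono⟩
    simp only [three_psum hb] at hc
    have h3 : ∀ i, r ≤ i → c i = B := by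
      intro i hi
      apply face_full hfd (hc i).1
      rw [(hc i).2, hr3, if_pos hi, if_pos (by omega), if_pos (by omega)]
    refine ⟨(if p < q then c p else ∅, if q < r then c q else B), ⟨?_, ?_, ?_, ?_, ?_⟩, ?_⟩
    · dsimp only
      split_ifs
      · exact (hc p).1
      · exact fun h => absurd h (by simp)
    · dsimp only
      split_ifs
      · exact (hc q).1
      · exact IsExposed.refl B
    · dsimp only
      split_ifs with h
      · rw [(hc p).2, if_pos le_rfl, if_neg (by omega), if_neg (by omega)]
      · exact rk_empty
    · dsimp only
      split_ifs with h
      · rw [(hc q).2, if_pos (by omega), if_pos (by omega), if_neg (by omega)]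
      · exact hr3
    · dsimp only
      split_ifs
      · exact hmono hpq
      · exact (hc p).1.subset
      · exact empty_subset _
      · exact empty_subset _
    · funext i
      unfold mkc
      dsimp only
      by_cases h1 : i < p
      · rw [if_pos h1]
        symm
        apply rk_eq_zero.1
        rw [(hc i).2, if_neg (by omega), if_neg (by omega), if_neg (by omega)]
      rw [if_neg h1]
      by_cases h2 : i < q
      · rw [if_pos h2, if_pos (by omega)]
        apply face_eq_of_rk hfd (hc p).1 (hc i).1 (hmono (by omega))
        rw [(hc p).2, (hc i).2]
        split_ifs <;> omega
      rw [if_neg h2]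
      by_cases h3' : i < r
      · rw [if_pos h3', if_pos (by omega)]
        apply face_eq_of_rk hfd (hc q).1 (hc i).1 (hmono (by omega))
        rw [(hc q).2, (hc i).2]
        split_ifs <;> omega
      rw [if_neg h3', h3 i (by omega)]
  · rintro _ ⟨⟨V, F⟩, ⟨hV, hF, hrV, hrF, hVF⟩, rfl⟩
    dsimp only at hV hF hrV hrF hVF
    refine ⟨fun i => ⟨?_, ?_⟩, ?_⟩
    · unfold mkc
      split_ifs
      · exact fun h => absurd h (by simp)
      · exact hV
      · exact hF
      · exact IsExposed.refl B
    · rw [three_psum hb]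
      unfold mkc
      dsimp only
      by_cases h1 : i < p
      · rw [if_pos h1, rk_empty, if_neg (by omega), if_neg (by omega), if_neg (by omega)]
      rw [if_neg h1]
      by_cases h2 : i < q
      · rw [if_pos h2, hrV, if_pos (by omega), if_pos (by omega), if_neg (by omega),
          if_neg (by omega)]
      rw [if_neg h2]
      by_cases h3' : i < r
      · rw [if_pos h3', hrF, if_pos (by omega), if_pos (by omega), if_pos (by omega),
          if_neg (by omega)]
      rw [if_neg h3', hr3, if_pos (by omega), if_pos (by omega), if_pos (by omega)]
    · intro i j hij
      unfold mkc
      dsimp only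
      split_ifs <;> first | exact empty_subset _ | exact hVF | exact hV.subset | exact hF.subset | exact Subset.rfl | omega

theorem mkc_inj {B : Set E} (hfd : FiniteDimensional ℝ (affineSpan ℝ B).direction)
    (hr3 : rk B = 3) {p q r : ℕ} (hpq : p ≤ q) (hqr : q ≤ r) :
    InjOn (mkc B p q r) (pairs B p q r) := by
  rintro ⟨V, F⟩ ⟨hV, hF, hrV, hrF, hVF⟩ ⟨V', F'⟩ ⟨hV', hF', hrV', hrF', hVF'⟩ heq
  dsimp only at *
  have e1 := congrFun heq p
  have e2 := congrFun heq q
  unfold mkc at e1 e2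
  dsimp only at e1 e2
  simp only [lt_irrefl, if_false, not_lt.2 hpq] at e1 e2
  have hVV : V = V' := by
    by_cases h : p < q
    · rwa [if_pos h, if_pos h] at e1
    · rw [if_neg h] at hrV hrV'
      rw [rk_eq_zero.1 hrV, rk_eq_zero.1 hrV']
  have hFF : F = F' := by
    by_cases h : q < r
    · rwa [if_pos h, if_pos h] at e2
    · rw [if_neg h] at hrF hrF'
      rw [face_full hfd hF (hrF.trans hr3.symm), face_full hfd hF' (hrF'.trans hr3.symm)]
  rw [hVV, hFF]

theorem edges_count {v : Finset E} {B : Set E} (hB : B = convexHull ℝ (v : Set E))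
    (hext : B.extremePoints ℝ = (v : Set E)) (hdim : pdim B = 2) (hcard : 3 ≤ v.card) :
    ∃ Ed : Finset (Set E), (∀ F, F ∈ Ed ↔ IsExposed ℝ B F ∧ rk F = 2) ∧ Ed.card = v.card ∧
      {w : Set E × Set E | (∃ x ∈ v, w.1 = {x}) ∧ w.2 ∈ Ed ∧ w.1 ⊆ w.2}.Finite ∧
      {w : Set E × Set E | (∃ x ∈ v, w.1 = {x}) ∧ w.2 ∈ Ed ∧ w.1 ⊆ w.2}.ncard = 2 * v.card := by
  classical
  have hfin : {F | IsExposed ℝ B F ∧ rk F = 2}.Finite := by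
    apply Set.Finite.of_finite_image (f := fun F => (v : Set E) ∩ F)
    · apply (v.finite_toSet.finite_subsets).subset
      rintro _ ⟨F, _, rfl⟩
      exact inter_subset_left
    · rintro F ⟨hF, _⟩ G ⟨hG, _⟩ h
      dsimp only at h
      rw [poly_face hB hext hF, h, ← poly_face hB hext hG]
  have hmem : ∀ F, F ∈ hfin.toFinset ↔ IsExposed ℝ B F ∧ rk F = 2 := fun F => by simp
  generalize hfin.toFinset = Ed at hmem
  have h1 : ∀ x ∈ v, (Ed.filter (fun F => x ∈ F)).card = 2 := by
    intro x hx
    obtain ⟨F1, F2, hne, heq⟩ := vertex_edges hB hext hdim hcard hx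
    have : Ed.filter (fun F => x ∈ F) = {F1, F2} := by
      ext F
      have := Set.ext_iff.1 heq F
      simp only [Finset.mem_filter, hmem, Finset.mem_insert, Finset.mem_singleton]
      simpa using this
    rw [this, Finset.card_pair hne]
  have h2 : ∀ F ∈ Ed, (v.filter (fun x => x ∈ F)).card = 2 := by
    intro F hF
    obtain ⟨hF1, hF2⟩ := (hmem F).1 hF
    obtain ⟨x, hx, y, hy, hne, heq⟩ := edge_pair hB hext hF1 hF2
    have : v.filter (fun z => z ∈ F) = {x, y} := by
      ext z
      have := Set.ext_iff.1 heq z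
      simpa using this
    rw [this, Finset.card_pair hne]
  have h3 := Finset.sum_card_bipartiteAbove_eq_sum_card_bipartiteBelow (s := v) (t := Ed)
    (fun x F => x ∈ F)
  unfold Finset.bipartiteAbove Finset.bipartiteBelow at h3
  rw [Finset.sum_congr rfl h1, Finset.sum_congr rfl h2] at h3
  simp only [Finset.sum_const, smul_eq_mul] at h3
  have himg : {w : Set E × Set E | (∃ x ∈ v, w.1 = {x}) ∧ w.2 ∈ Ed ∧ w.1 ⊆ w.2} =
      (fun q : (Σ _ : E, Set E) => (({q.1} : Set E), q.2)) ''
        ((v.sigma fun x => Ed.filter (fun F => x ∈ F) : Finset (Σ _ : E, Set E)) :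
          Set (Σ _ : E, Set E)) := by
    ext ⟨V, F⟩
    constructor
    · rintro ⟨⟨x, hx, hV⟩, hF, hVF⟩
      dsimp only at hV hF hVF
      subst hV
      refine ⟨⟨x, F⟩, ?_, rfl⟩
      simp only [Finset.mem_coe, Finset.mem_sigma, Finset.mem_filter]
      exact ⟨hx, hF, by simpa using hVF⟩
    · rintro ⟨⟨x, F'⟩, hq, heq⟩
      simp only [Finset.mem_coe, Finset.mem_sigma, Finset.mem_filter] at hq
      simp only [Prod.mk.injEq] at heq
      obtain ⟨rfl, rfl⟩ := heq
      exact ⟨⟨x, hq.1, rfl⟩, hq.2.1, by simpa using hq.2.2⟩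
  refine ⟨Ed, hmem, by omega, ?_, ?_⟩
  · rw [himg]
    exact (Finset.finite_toSet _).image _
  · rw [himg, ncard_image_of_injective, ncard_coe_finset, Finset.card_sigma,
      Finset.sum_congr rfl h1]
    · simp [mul_comm]
    · rintro ⟨x, F⟩ ⟨y, G⟩ h
      simp only [Prod.mk.injEq, singleton_eq_singleton_iff] at h
      obtain ⟨rfl, rfl⟩ := h
      rfl

theorem good_polygon {p : ℕ} {B : Set E} (h : IsPolygon p B) (hp : 3 ≤ p) :
    Good B 3 (2 * p) ((p - 3) / 3) := by
  classical
  obtain ⟨v, hcard, hB, hext, hdim⟩ := h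
  have hfd := poly_fd hB
  have hvne : v.Nonempty := Finset.card_pos.1 (by omega)
  have hBne : B.Nonempty := by
    rw [hB]; exact (convexHull_nonempty_iff).2 hvne
  have hr3 : rk B = 3 := by rw [rk_of_nonempty hBne, hdim]
  obtain ⟨Ed, hEd, hEdc, hIf, hIc⟩ := edges_count hB hext hdim (by omega)
  refine ⟨by rw [hB]; exact convex_convexHull ℝ _, hfd, hr3, ?_⟩
  intro n b hz hsum
  obtain ⟨i, j, k, hij, hjk, hkn, hb⟩ := three_split hsum hz
  have hch := chains_eq hfd hr3 hij hjk hb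
  have hinj := mkc_inj hfd hr3 hij hjk
  rw [hch, ncard_image_of_injOn hinj]
  have hprod : ∀ f : ℕ → ℚ, f 0 = 1 → f 1 = 1 → ∏ l ∈ Finset.range n, f (b l) =
      if i = j then (if j = k then f 3 else f 2) else if j = k then f 2 else 1 := by
    intro f h0 h1
    have hout : ∀ l, l ≠ i → l ≠ j → l ≠ k → f (b l) = 1 := by
      intro l h1 h2 h3
      rw [hb, if_neg h1, if_neg h2, if_neg h3]; exact h0
    by_cases hij' : i = j
    · subst hij'
      by_cases hjk' : i = k
      · subst hjk'
        rw [Finset.prod_eq_single i (fun l _ hl => hout l hl hl hl)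
          (fun h => absurd (Finset.mem_range.2 hkn) h), hb]
        simp
      · rw [Finset.prod_eq_mul i k hjk' (fun l _ hl => hout l hl.1 hl.1 hl.2)
          (fun h => absurd (Finset.mem_range.2 (by omega)) h)
          (fun h => absurd (Finset.mem_range.2 hkn) h), hb, hb]
        simp [hjk', Ne.symm hjk', h1]
    · by_cases hjk' : j = k
      · subst hjk'
        rw [Finset.prod_eq_mul i j hij' (fun l _ hl => hout l hl.1 hl.2 hl.2)
          (fun h => absurd (Finset.mem_range.2 (by omega)) h)
          (fun h => absurd (Finset.mem_range.2 hkn) h), hb, hb]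
        simp [hij', Ne.symm hij', h1]
      · rw [if_neg hij', if_neg hjk']
        apply Finset.prod_eq_one
        intro l _
        rw [hb]
        split_ifs <;> first | omega | simp [h0, h1]
  have hS : ∑ l ∈ Finset.range n, (b l : ℚ) * ((b l : ℚ) - 1) * ((b l : ℚ) - 2) =
      if i = j ∧ j = k then 6 else 0 := by
    split_ifs with hc
    · obtain ⟨rfl, rfl⟩ := hc
      rw [Finset.sum_eq_single i]
      · rw [hb]; norm_num
      · intro l _ hl
        rw [hb]; simp [hl]
      · exact fun h => absurd (Finset.mem_range.2 hkn) h
    · apply Finset.sum_eq_zero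
      intro l _
      have hle : b l ≤ 2 := by
        rw [hb]
        split_ifs <;> omega
      interval_cases b l <;> norm_num
  rw [hS, hprod (fun l => (l.factorial : ℚ)) (by simp) (by simp)]
  have hV0 : ∀ V : Set E, rk V = 0 ↔ V = ∅ := fun V => rk_eq_zero
  have hE0 : IsExposed ℝ B ∅ := isExposed_empty
  have hBB : IsExposed ℝ B B := IsExposed.refl B
  by_cases hij' : i = j
  · subst hij'
    by_cases hjk' : i = k
    · subst hjk'
      have : pairs B i i i = {(∅, B)} := by
        ext ⟨V, F⟩
        simp only [pairs, lt_irrefl, if_false, mem_setOf_eq, mem_singleton_iff, Prod.mk.injEq]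
        constructor
        · rintro ⟨h1, h2, h3, h4, h5⟩
          exact ⟨rk_eq_zero.1 h3, face_full hfd h2 (h4.trans hr3.symm)⟩
        · rintro ⟨rfl, rfl⟩
          exact ⟨hE0, hBB, rk_empty, hr3, empty_subset _⟩
      rw [this]
      refine ⟨(finite_singleton _).image _, ?_⟩
      rw [ncard_singleton]
      simp [Nat.factorial]
      ring
    · have : pairs B i i k = (fun F => ((∅ : Set E), F)) '' (Ed : Set (Set E)) := by
        ext ⟨V, F⟩
        simp only [pairs, lt_irrefl, if_false, mem_setOf_eq, mem_image, Prod.mk.injEq,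
          if_pos (lt_of_le_of_ne hjk hjk'), Finset.mem_coe]
        constructor
        · rintro ⟨h1, h2, h3, h4, h5⟩
          exact ⟨F, (hEd F).2 ⟨h2, h4⟩, (rk_eq_zero.1 h3).symm, rfl⟩
        · rintro ⟨F', h1, rfl, rfl⟩
          exact ⟨hE0, ((hEd _).1 h1).1, rk_empty, ((hEd _).1 h1).2, empty_subset _⟩
      rw [this]
      refine ⟨((Finset.finite_toSet _).image _).image _, ?_⟩
      rw [ncard_image_of_injective _ (fun _ _ h => (Prod.mk.inj h).2), ncard_coe_finset, hEdc, hcard]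
      simp [hjk', Nat.factorial]
      ring
  · by_cases hjk' : j = k
    · subst hjk'
      have : pairs B i j j = (fun x => (({x} : Set E), B)) '' (v : Set E) := by
        ext ⟨V, F⟩
        simp only [pairs, lt_irrefl, if_false, mem_setOf_eq, mem_image, Prod.mk.injEq,
          if_pos (lt_of_le_of_ne hij hij'), Finset.mem_coe]
        constructor
        · rintro ⟨h1, h2, h3, h4, h5⟩
          obtain ⟨x, hx, rfl⟩ := (vertex_faces hB hext V).1 ⟨h1, h3⟩
          exact ⟨x, hx, rfl, (face_full hfd h2 (h4.trans hr3.symm)).symm⟩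
        · rintro ⟨x, h1, rfl, rfl⟩
          have := (vertex_faces hB hext {x}).2 ⟨x, h1, rfl⟩
          exact ⟨this.1, hBB, this.2, hr3, this.1.subset⟩
      rw [this]
      refine ⟨((Finset.finite_toSet _).image _).image _, ?_⟩
      rw [ncard_image_of_injective _ (fun _ _ h => by simpa using (Prod.mk.inj h).1),
        ncard_coe_finset, hcard]
      simp [hij', Nat.factorial]
      ring
    · have : pairs B i j k =
          {w : Set E × Set E | (∃ x ∈ v, w.1 = {x}) ∧ w.2 ∈ Ed ∧ w.1 ⊆ w.2} := by
        ext ⟨V, F⟩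
        simp only [pairs, mem_setOf_eq, if_pos (lt_of_le_of_ne hij hij'),
          if_pos (lt_of_le_of_ne hjk hjk'), ← vertex_faces hB hext V, hEd F]
        tauto
      rw [this]
      refine ⟨hIf.image _, ?_⟩
      rw [hIc, hcard]
      simp [hij', hjk']

theorem good_kfold {B : Set E} {x y : ℚ} (h : Good B 3 x y) : ∀ (k : ℕ) (Q : Set E),
    IsKFoldPyramid k Q B →
      Good Q (k + 3) (((k + 3).factorial : ℚ) / 6 * x) ((k.factorial : ℚ) * y) := by
  intro k
  induction k with
  | zero =>
    intro Q hQ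
    have hQ' : Q = B := hQ
    subst hQ'
    have e : ((0 + 3).factorial : ℚ) / 6 * x = x := by simp [Nat.factorial]
    rw [e]
    simpa using h
  | succ k ih =>
    rintro Q ⟨R, a, hR, ha, rfl⟩
    have := good_pyr (ih R hR) ha
    convert this using 1
    · rw [show k + 1 + 3 = (k + 3) + 1 by ring, Nat.factorial_succ]
      push_cast; ring
    · rw [Nat.factorial_succ]
      push_cast; ring

theorem good_simplex (v : Finset E) (hind : AffineIndependent ℝ (fun p : ↥v => (p : E))) :
    Good (convexHull ℝ (v : Set E)) v.card (v.card.factorial : ℚ) 0 := by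
  classical
  induction v using Finset.induction_on with
  | empty => simpa using good_empty (E := E)
  | insert a v ha ih =>
    have hv : AffineIndependent ℝ (fun p : ↥v => (p : E)) :=
      AffineIndependent.mono (s := (v : Set E)) (t := ((insert a v : Finset E) : Set E)) hind
        (by simp)
    have han : a ∉ affineSpan ℝ (convexHull ℝ (v : Set E)) := by
      rw [affineSpan_convexHull]
      have := hind.notMem_affineSpan_sdiff ⟨a, Finset.mem_insert_self a v⟩ Set.univ
      intro hmem
      apply this
      refine affineSpan_mono ℝ ?_ hmem
      intro x hx
      refine ⟨⟨x, Finset.mem_insert_of_mem hx⟩, ⟨mem_univ _, ?_⟩, rfl⟩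
      intro h
      have hxa : x = a := congrArg Subtype.val h
      exact ha (hxa ▸ hx)
    have := good_pyr (ih hv) han
    have e : convexHull ℝ (insert a (convexHull ℝ (v : Set E))) =
        convexHull ℝ ((insert a v : Finset E) : Set E) := by
      rw [Finset.coe_insert]
      apply Subset.antisymm
      · apply convexHull_min _ (convex_convexHull ℝ _)
        apply insert_subset
        · exact subset_convexHull ℝ _ (mem_insert _ _)
        · exact convexHull_mono (subset_insert _ _)
      · exact convexHull_mono (insert_subset_insert (subset_convexHull ℝ _))
    rw [e] at this
    rw [Finset.card_insert_of_notMem ha, Nat.factorial_succ]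
    convert this using 1
    · push_cast; ring
    · ring

def stepB (σ : ℕ → ℕ) : ℕ → ℕ
  | 0 => σ 0 + 1
  | (i + 1) => σ (i + 1) - σ i

theorem stepB_psum {σ : ℕ → ℕ} (hσ : Monotone σ) (i : ℕ) :
    ∑ j ∈ Finset.range (i + 1), stepB σ j = σ i + 1 := by
  induction i with
  | zero => simp [stepB]
  | succ i ih =>
    rw [Finset.sum_range_succ, ih]
    have := hσ (Nat.le_succ i)
    simp only [stepB]
    simp only [Nat.succ_eq_add_one] at this
    omega

theorem flag_eq {P : Set E} (hfd : FiniteDimensional ℝ (affineSpan ℝ P).direction) {d r : ℕ}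
    (hrk : rk P = d + 1) {σ : ℕ → ℕ} (hσ : Monotone σ) (htop : ∀ i, r ≤ i → σ i = d)
    (hinj : ∀ i < r, ∀ j < r, σ i ≤ σ j → i ≤ j) :
    flagNum P ((Finset.range r).image σ) = (chains P (stepB σ)).ncard := by
  classical
  have hS : ∀ i < r, σ i ∈ (Finset.range r).image σ := fun i hi =>
    Finset.mem_image_of_mem _ (Finset.mem_range.2 hi)
  unfold flagNum
  refine Set.ncard_congr (fun g _ i => if i < r then g (σ i) else P) ?_ ?_ ?_
  · rintro g ⟨h1, h2, h3⟩
    refine ⟨fun i => ?_, ?_⟩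
    · rw [stepB_psum hσ]
      dsimp only
      split_ifs with hi
      · obtain ⟨⟨ha, hb⟩, hc⟩ := h1 _ (hS i hi)
        exact ⟨ha, by rw [rk_of_nonempty hb, hc]⟩
      · exact ⟨IsExposed.refl P, by rw [hrk, htop i (by omega)]⟩
    · intro i j hij
      dsimp only
      split_ifs with hi hj hj
      · exact h2 _ (hS i hi) _ (hS j hj) (hσ hij)
      · exact (h1 _ (hS i hi)).1.1.subset
      · omega
      · exact Subset.rfl
  · rintro g g' ⟨h1, h2, h3⟩ ⟨h1', h2', h3'⟩ heq
    funext x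
    by_cases hx : x ∈ (Finset.range r).image σ
    · obtain ⟨i, hi, rfl⟩ := Finset.mem_image.1 hx
      have := congrFun heq i
      simpa [Finset.mem_range.1 hi] using this
    · rw [h3 x hx, h3' x hx]
  · rintro c ⟨hc, hmono⟩
    simp only [stepB_psum hσ] at hc
    have hex : ∃ g : ℕ → Set E, (∀ i < r, g (σ i) = c i) ∧
        ∀ x, x ∉ (Finset.range r).image σ → g x = ∅ := by
      refine ⟨fun x => if h : ∃ i < r, σ i = x then c h.choose else ∅, ?_, ?_⟩
      · intro i hi
        have h : ∃ k < r, σ k = σ i := ⟨i, hi, rfl⟩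
        dsimp only
        rw [dif_pos h]
        have hs := h.choose_spec
        congr 1
        exact le_antisymm (hinj _ hs.1 _ hi hs.2.le) (hinj _ hi _ hs.1 hs.2.ge)
      · intro x hx
        dsimp only
        rw [dif_neg]
        rintro ⟨i, hi, rfl⟩
        exact hx (hS i hi)
    obtain ⟨g, hg1, hg2⟩ := hex
    refine ⟨g, ⟨?_, ?_, hg2⟩, ?_⟩
    · intro x hx
      obtain ⟨i, hi, rfl⟩ := Finset.mem_image.1 hx
      rw [hg1 i (Finset.mem_range.1 hi)]
      have hne : (c i).Nonempty := by
        rw [nonempty_iff_ne_empty]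
        intro h0
        have := (hc i).2
        rw [h0, rk_empty] at this
        omega
      refine ⟨⟨(hc i).1, hne⟩, ?_⟩
      have := (hc i).2
      rw [rk_of_nonempty hne] at this
      omega
    · intro x hx y hy hxy
      obtain ⟨i, hi, rfl⟩ := Finset.mem_image.1 hx
      obtain ⟨j, hj, rfl⟩ := Finset.mem_image.1 hy
      rw [hg1 i (Finset.mem_range.1 hi), hg1 j (Finset.mem_range.1 hj)]
      exact hmono (hinj i (Finset.mem_range.1 hi) j (Finset.mem_range.1 hj) hxy)
    · funext i
      split_ifs with hi
      · exact hg1 i hi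
      · symm
        apply face_full hfd (hc i).1
        rw [(hc i).2, hrk, htop i (by omega)]

theorem telescope {σ : ℕ → ℕ} (hσ : Monotone σ) (r : ℕ) :
    ∑ j ∈ Finset.range (r + 1), (stepB σ j : ℚ) * ((stepB σ j : ℚ) - 1) * ((stepB σ j : ℚ) - 2) =
      ((σ r : ℚ) + 1) * (σ r : ℚ) * ((σ r : ℚ) - 1) -
        3 * ∑ j ∈ Finset.range r, ((σ j : ℚ) + 1) * ((σ (j + 1) : ℚ) - (σ j : ℚ)) *
          ((σ (j + 1) : ℚ) - 1) := by
  induction r with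
  | zero =>
    rw [Finset.sum_range_one, Finset.sum_range_zero]
    simp only [stepB]
    push_cast
    ring
  | succ r ih =>
    rw [Finset.sum_range_succ, ih, Finset.sum_range_succ]
    have h : (stepB σ (r + 1) : ℚ) = (σ (r + 1) : ℚ) - σ r := by
      simp only [stepB]
      rw [Nat.cast_sub (hσ (Nat.le_succ r))]
    rw [h]
    ring

theorem flag_formula {P : Set E} {d r : ℕ} {x y : ℚ} (hP : Good P (d + 1) x y)
    {σ : ℕ → ℕ} (hσ : Monotone σ) (htop : ∀ i, r ≤ i → σ i = d)
    (hinj : ∀ i < r, ∀ j < r, σ i ≤ σ j → i ≤ j) :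
    (flagNum P ((Finset.range r).image σ) : ℚ) *
      (((σ 0 + 1).factorial : ℚ) * ∏ j ∈ Finset.range r, ((σ (j + 1) - σ j).factorial : ℚ)) =
      x - y * (((d : ℚ) + 1) * d * ((d : ℚ) - 1) -
        3 * ∑ j ∈ Finset.range r, ((σ j : ℚ) + 1) * ((σ (j + 1) : ℚ) - (σ j : ℚ)) *
          ((σ (j + 1) : ℚ) - 1)) := by
  obtain ⟨_, hfd, hrk, hc⟩ := hP
  have h := (hc (r + 1) (stepB σ) (by
    intro i hi
    obtain ⟨i, rfl⟩ : ∃ k, i = k + 1 := ⟨i - 1, by omega⟩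
    simp only [stepB]
    rw [htop i (by omega), htop (i + 1) (by omega), Nat.sub_self]) (by
    rw [stepB_psum hσ, htop r le_rfl])).2
  rw [telescope hσ, htop r le_rfl, Finset.prod_range_succ', ← flag_eq hfd hrk hσ htop hinj] at h
  rw [← h]
  simp only [stepB]
  ring
/-- For `n > d ≥ 2`, `m = n - d`, `Q^{d,m}` the `(d-2)`-fold pyramid over the
`(m+3)`-gon and `T^d` the `d`-simplex, and `S = {s_1 < … < s_r} ⊆ {0,…,d-1}`
(encoded by a strictly increasing `s : Fin (r+1) → ℕ` with `s (Fin.last r) = d`),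
`f_S(Q^{d,m}) - f_S(T^d)` equals the multinomial coefficient
`(d+1)!/((s_1+1)!(s_2-s_1)!…(d-s_r)!)` times
`m/((d+1)d(d-1)) · Σ_{j=1}^r (s_j+1)(s_{j+1}-s_j)(s_{j+1}-1)`. -/
theorem pyramid_sub_simplex_flag_vector (d n : ℕ) (hd : 2 ≤ d) (hdn : d < n)
    (B Q : Set E) (hB : IsPolygon ((n - d) + 3) B) (hQ : IsKFoldPyramid (d - 2) Q B)
    (T : Set E) (v : Finset E) (hind : AffineIndependent ℝ (fun p : ↥v => (p : E)))
    (hcard : v.card = d + 1) (hT : T = convexHull ℝ (v : Set E))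
    (r : ℕ) (s : Fin (r + 1) → ℕ) (hs : StrictMono s) (hlast : s (Fin.last r) = d) :
    (flagNum Q (Finset.image (fun j : Fin r => s j.castSucc) Finset.univ) : ℚ) -
      (flagNum T (Finset.image (fun j : Fin r => s j.castSucc) Finset.univ) : ℚ) =
      ((Nat.factorial (d + 1) : ℚ) /
        ((Nat.factorial (s 0 + 1) : ℚ) *
          ∏ j : Fin r, (Nat.factorial (s j.succ - s j.castSucc) : ℚ))) *
      (((n - d : ℕ) : ℚ) / (((d : ℚ) + 1) * (d : ℚ) * ((d : ℚ) - 1)) *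
        ∑ j : Fin r,
          ((s j.castSucc : ℚ) + 1) * ((s j.succ : ℚ) - (s j.castSucc : ℚ)) *
            ((s j.succ : ℚ) - 1)) := by

  let σ : ℕ → ℕ := fun i => s ⟨min i r, by omega⟩
  have hσ : Monotone σ := by
    intro i j hij
    apply hs.monotone
    rw [Fin.mk_le_mk]
    omega
  have htop : ∀ i, r ≤ i → σ i = d := by
    intro i hi
    rw [← hlast]
    apply congrArg s
    apply Fin.ext
    simp [hi]
  have hinj : ∀ i < r, ∀ j < r, σ i ≤ σ j → i ≤ j := by
    intro i hi j hj h
    have := hs.le_iff_le.1 h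
    rw [Fin.mk_le_mk] at this
    omega
  have hcast : ∀ j : Fin r, s j.castSucc = σ j := by
    intro j
    apply congrArg s
    apply Fin.ext
    simp
  have hsucc : ∀ j : Fin r, s j.succ = σ (j + 1) := by
    intro j
    apply congrArg s
    apply Fin.ext
    simp
  have h0 : s 0 = σ 0 := by
    apply congrArg s
    apply Fin.ext
    simp
  have hS : Finset.image (fun j : Fin r => s j.castSucc) Finset.univ =
      (Finset.range r).image σ := by
    ext x
    simp only [Finset.mem_image, Finset.mem_univ, true_and, Finset.mem_range, hcast]
    constructor
    · rintro ⟨j, rfl⟩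
      exact ⟨j, j.2, rfl⟩
    · rintro ⟨i, hi, rfl⟩
      exact ⟨⟨i, hi⟩, rfl⟩
  have hprod : ∏ j : Fin r, (Nat.factorial (s j.succ - s j.castSucc) : ℚ) =
      ∏ j ∈ Finset.range r, ((σ (j + 1) - σ j).factorial : ℚ) := by
    rw [Finset.prod_range]
    exact Finset.prod_congr rfl (fun j _ => by rw [hsucc, hcast])
  have hsum : ∑ j : Fin r, ((s j.castSucc : ℚ) + 1) * ((s j.succ : ℚ) - (s j.castSucc : ℚ)) *
            ((s j.succ : ℚ) - 1) =
      ∑ j ∈ Finset.range r, ((σ j : ℚ) + 1) * ((σ (j + 1) : ℚ) - (σ j : ℚ)) *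
          ((σ (j + 1) : ℚ) - 1) := by
    rw [Finset.sum_range]
    exact Finset.sum_congr rfl (fun j _ => by rw [hsucc, hcast])
  rw [hS, hprod, hsum, h0]
  have hGQ := good_kfold (good_polygon hB (by omega)) (d - 2) Q hQ
  have hGT := good_simplex v hind
  rw [← hT, hcard] at hGT
  obtain ⟨e, rfl⟩ : ∃ e, d = e + 2 := ⟨d - 2, by omega⟩
  rw [show e + 2 - 2 + 3 = e + 2 + 1 by omega, show e + 2 - 2 = e by omega] at hGQ
  have hQ1 := flag_formula hGQ hσ htop hinj
  have hT1 := flag_formula hGT hσ htop hinj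
  set X := ((σ 0 + 1).factorial : ℚ) *
    ∏ j ∈ Finset.range r, ((σ (j + 1) - σ j).factorial : ℚ) with hX
  have hXne : X ≠ 0 := by
    rw [hX]
    apply mul_ne_zero
    · exact_mod_cast Nat.factorial_ne_zero _
    · apply Finset.prod_ne_zero_iff.2
      intro j _
      exact_mod_cast Nat.factorial_ne_zero _
  have hfac : ((e + 2 + 1).factorial : ℚ) = ((e : ℚ) + 3) * (e + 2) * (e + 1) * e.factorial := by
    rw [Nat.factorial_succ, Nat.factorial_succ, Nat.factorial_succ]
    push_cast
    ring
  rw [hfac] at hQ1 hT1 ⊢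
  apply mul_right_cancel₀ hXne
  rw [sub_mul, hQ1, hT1]
  have h1 : (e : ℚ) + 1 ≠ 0 := by positivity
  have h2 : (e : ℚ) + 2 ≠ 0 := by positivity
  have h3 : (e : ℚ) + 3 ≠ 0 := by positivity
  generalize (n - (e + 2)) = m
  have hden : (((e + 2 : ℕ) : ℚ) + 1) * ((e + 2 : ℕ) : ℚ) * (((e + 2 : ℕ) : ℚ) - 1) =
      ((e : ℚ) + 3) * (e + 2) * (e + 1) := by
    push_cast; ring
  rw [hden]
  push_cast
  field_simp
  ring
end

section
/- The multiplex M^{d,n} satisfies f_{0,i}(M^{d,n}) = (n+1)·C(d,i) + (d-2)(n-d)·C(d-2, i-1) for 0 ≤ i ≤ d-1, where f_{0,i} is the number of incident (vertex, i-face) pairs. -/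
open Set

variable {E : Type*} [NormedAddCommGroup E] [NormedSpace ℝ E]

/-- The binomial coefficient `C(a,b)` for integer arguments, with the convention
that it is `0` when `b < 0` or `b > a`. -/
def Cz (a b : ℤ) : ℤ := if 0 ≤ a ∧ 0 ≤ b then (a.toNat.choose b.toNat : ℤ) else 0


section Geometry

/-- `Y` is the set of maximisers of a linear functional on the points `x j`, `j ∈ V`. -/
def IsSupp (V : Finset ℤ) (x : ℤ → E) (Y : Finset ℤ) : Prop :=
  Y ⊆ V ∧ ∃ (l : E →L[ℝ] ℝ) (M : ℝ), ∀ j ∈ V, l (x j) ≤ M ∧ (l (x j) = M ↔ j ∈ Y)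

/-- dimension of the affine span of the points indexed by `Y`. -/
noncomputable def pd (x : ℤ → E) (Y : Finset ℤ) : ℕ :=
  Module.finrank ℝ (vectorSpan ℝ (x '' (Y : Set ℤ)))

/-- convex hull of the points indexed by `Y`. -/
def hul (x : ℤ → E) (Y : Finset ℤ) : Set E := convexHull ℝ (x '' (Y : Set ℤ))

lemma pdim_hul (x : ℤ → E) (Y : Finset ℤ) : pdim (hul x Y) = pd x Y := by
  unfold pdim hul pd
  rw [affineSpan_convexHull, direction_affineSpan]

lemma fd_span (x : ℤ → E) (Y : Finset ℤ) :
    FiniteDimensional ℝ (vectorSpan ℝ (x '' (Y : Set ℤ))) :=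
  finiteDimensional_vectorSpan_of_finite ℝ (Y.finite_toSet.image x)

lemma span_le_ker (x : ℤ → E) (Y : Finset ℤ) (l : E →L[ℝ] ℝ) (M : ℝ)
    (h : ∀ j ∈ Y, l (x j) = M) : vectorSpan ℝ (x '' (Y : Set ℤ)) ≤ LinearMap.ker l.toLinearMap := by
  unfold vectorSpan
  rw [Submodule.span_le]
  rintro _ ⟨_, ⟨a, ha, rfl⟩, _, ⟨b, hb, rfl⟩, rfl⟩
  simp [h a ha, h b hb]

lemma pd_lt {V : Finset ℤ} {x : ℤ → E} {Y Z : Finset ℤ} (hY : IsSupp V x Y) (hne : Y.Nonempty)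
    (hZ : Z ⊆ V) (hYZ : Y ⊆ Z) {w : ℤ} (hw : w ∈ Z) (hwY : w ∉ Y) : pd x Y < pd x Z := by
  obtain ⟨hYV, l, M, hl⟩ := hY
  obtain ⟨y, hy⟩ := hne
  have := fd_span x Z
  apply Submodule.finrank_lt_finrank_of_lt
  refine lt_of_le_of_ne (vectorSpan_mono ℝ (Set.image_mono (by exact_mod_cast hYZ))) ?_
  intro heq
  have h1 : x w -ᵥ x y ∈ vectorSpan ℝ (x '' (Z : Set ℤ)) :=
    vsub_mem_vectorSpan ℝ ⟨w, hw, rfl⟩ ⟨y, hYZ hy, rfl⟩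
  rw [← heq] at h1
  have h2 := span_le_ker x Y l M (fun j hj => ((hl j (hYV hj)).2).2 hj) h1
  have h3 := (hl y (hYV hy)).2.2 hy
  simp only [vsub_eq_sub, LinearMap.mem_ker, ContinuousLinearMap.coe_coe, map_sub] at h2
  exact hwY ((hl w (hZ hw)).2.1 (by linarith))

lemma pd_le_card (x : ℤ → E) (Y : Finset ℤ) (k : ℕ) (h : Y.card = k + 1) : pd x Y ≤ k := by
  classical
  have := finrank_vectorSpan_image_finset_le ℝ x Y h
  rw [Finset.coe_image] at this
  exact this

lemma supp_univ (V : Finset ℤ) (x : ℤ → E) : IsSupp V x V :=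
  ⟨subset_rfl, 0, 0, fun j hj => by simp [hj]⟩

lemma supp_inter {V : Finset ℤ} {x : ℤ → E} {Y Z : Finset ℤ} (hY : IsSupp V x Y)
    (hZ : IsSupp V x Z) : IsSupp V x (Y ∩ Z) := by
  obtain ⟨hYV, l, M, hl⟩ := hY
  obtain ⟨hZV, l', M', hl'⟩ := hZ
  refine ⟨fun j hj => hYV (Finset.mem_inter.1 hj).1, l + l', M + M', fun j hj => ?_⟩
  obtain ⟨a, b⟩ := hl j hj
  obtain ⟨a', b'⟩ := hl' j hj
  rw [Finset.mem_inter, ← b, ← b']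
  simp only [add_apply]
  refine ⟨by linarith, fun h => ⟨by linarith, by linarith⟩, fun h => by linarith [h.1, h.2]⟩

lemma supp_face {V : Finset ℤ} {x : ℤ → E} {Y : Finset ℤ} (hY : IsSupp V x Y)
    (hne : Y.Nonempty) : IsFaceOf (hul x V) (hul x Y) := by
  obtain ⟨hYV, l, M, hl⟩ := hY
  obtain ⟨y, hy⟩ := hne
  have hyY : x y ∈ hul x Y := subset_convexHull ℝ _ ⟨y, hy, rfl⟩
  have hsub : hul x Y ⊆ hul x V := convexHull_mono (Set.image_mono (by exact_mod_cast hYV))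
  have hle : ∀ z ∈ hul x V, l z ≤ M := by
    intro z hz
    have : hul x V ⊆ {z | l z ≤ M} := by
      apply convexHull_min
      · rintro _ ⟨j, hj, rfl⟩
        exact (hl j hj).1
      · exact convex_halfSpace_le l.toLinearMap.isLinear M
    exact this hz
  have heq : ∀ z ∈ hul x Y, l z = M := by
    intro z hz
    have : hul x Y ⊆ {z | l z = M} := by
      apply convexHull_min
      · rintro _ ⟨j, hj, rfl⟩
        exact (hl j (hYV hj)).2.2 hj
      · exact convex_hyperplane l.toLinearMap.isLinear M
    exact this hz
  refine ⟨fun _ => ⟨l, ?_⟩, ⟨x y, hyY⟩⟩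
  apply Set.Subset.antisymm
  · intro z hz
    exact ⟨hsub hz, fun w hw => by rw [heq z hz]; exact hle w hw⟩
  · rintro z ⟨hz, hmax⟩
    have hzM : l z = M := le_antisymm (hle z hz) (by rw [← heq _ hyY]; exact hmax _ (hsub hyY))
    classical
    have hz' : z ∈ convexHull ℝ ((V.image x : Finset E) : Set E) := by simpa [hul] using hz
    rw [Finset.mem_convexHull'] at hz'
    obtain ⟨w, w0, w1, wz⟩ := hz'
    have hM : ∀ e ∈ V.image x, l e ≤ M := by
      intro e he
      obtain ⟨j, hj, rfl⟩ := Finset.mem_image.1 he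
      exact (hl j hj).1
    have hsum : ∑ e ∈ V.image x, w e * (M - l e) = 0 := by
      have : l z = ∑ e ∈ V.image x, w e * l e := by
        rw [← wz, map_sum]; simp
      simp only [mul_sub, Finset.sum_sub_distrib, ← Finset.sum_mul, w1, ← this, hzM]
      ring
    have hzero := (Finset.sum_eq_zero_iff_of_nonneg
      (fun e he => mul_nonneg (w0 e he) (sub_nonneg.2 (hM e he)))).1 hsum
    have hw : ∀ e ∈ V.image x, e ∉ Y.image x → w e = 0 := by
      intro e he heY
      rcases mul_eq_zero.1 (hzero e he) with h | h
      · exact h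
      · exfalso
        obtain ⟨j, hj, rfl⟩ := Finset.mem_image.1 he
        exact heY (Finset.mem_image_of_mem x ((hl j hj).2.1 (by linarith)))
    have hsubs : Y.image x ⊆ V.image x := Finset.image_subset_image hYV
    have : z ∈ convexHull ℝ ((Y.image x : Finset E) : Set E) := by
      rw [Finset.mem_convexHull']
      refine ⟨w, fun e he => w0 e (hsubs he), ?_, ?_⟩
      · rw [← w1]
        exact Finset.sum_subset hsubs hw
      · rw [← wz]
        exact Finset.sum_subset hsubs (fun e he heY => by rw [hw e he heY, zero_smul])
    simpa [hul] using this

lemma face_supp {V : Finset ℤ} {x : ℤ → E} {F : Set E} (hF : IsFaceOf (hul x V) F) :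
    ∃ Y : Finset ℤ, Y.Nonempty ∧ IsSupp V x Y ∧ F = hul x Y := by
  classical
  obtain ⟨hex, z, hz⟩ := hF
  obtain ⟨l, hl⟩ := hex ⟨z, hz⟩
  have hz2 : z ∈ {x_1 | x_1 ∈ hul x V ∧ ∀ y ∈ hul x V, l y ≤ l x_1} := hl ▸ hz
  have hV : ∀ j ∈ V, x j ∈ hul x V := fun j hj => subset_convexHull ℝ _ ⟨j, hj, rfl⟩
  have hsupp : IsSupp V x (V.filter fun j => l (x j) = l z) := by
    refine ⟨Finset.filter_subset _ _, l, l z, fun j hj => ⟨hz2.2 _ (hV j hj), by simp [hj]⟩⟩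
  have hne : (V.filter fun j => l (x j) = l z).Nonempty := by
    by_contra hne
    rw [Finset.not_nonempty_iff_eq_empty] at hne
    have : hul x V ⊆ {y | l y < l z} := by
      apply convexHull_min
      · rintro _ ⟨j, hj, rfl⟩
        refine lt_of_le_of_ne (hz2.2 _ (hV j hj)) fun h => ?_
        have : j ∈ (V.filter fun j => l (x j) = l z) := Finset.mem_filter.2 ⟨hj, h⟩
        rw [hne] at this
        simp at this
      · exact convex_halfSpace_lt l.toLinearMap.isLinear _
    exact lt_irrefl (l z) (this hz2.1)
  refine ⟨_, hne, hsupp, ?_⟩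
  obtain ⟨y, hy⟩ := hne
  have hy' := Finset.mem_filter.1 hy
  obtain ⟨hex', -⟩ := supp_face hsupp ⟨y, hy⟩
  have hle : ∀ w ∈ hul x V, l w ≤ l z := hz2.2
  have hyH : x y ∈ hul x (V.filter fun j => l (x j) = l z) :=
    subset_convexHull ℝ _ ⟨y, hy, rfl⟩
  -- identify the exposed sets
  apply Set.Subset.antisymm
  · intro w hw
    rw [hl] at hw
    have hwz : l w = l z := le_antisymm (hle w hw.1) (hw.2 z hz2.1)
    have hw' : w ∈ convexHull ℝ ((V.image x : Finset E) : Set E) := by simpa [hul] using hw.1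
    rw [Finset.mem_convexHull'] at hw'
    obtain ⟨c, c0, c1, cw⟩ := hw'
    have hM : ∀ e ∈ V.image x, l e ≤ l z := by
      intro e he
      obtain ⟨j, hj, rfl⟩ := Finset.mem_image.1 he
      exact hle _ (hV j hj)
    have hsum : ∑ e ∈ V.image x, c e * (l z - l e) = 0 := by
      have : l w = ∑ e ∈ V.image x, c e * l e := by
        rw [← cw, map_sum]; simp
      simp only [mul_sub, Finset.sum_sub_distrib, ← Finset.sum_mul, c1, ← this, hwz]
      ring
    have hzero := (Finset.sum_eq_zero_iff_of_nonneg
      (fun e he => mul_nonneg (c0 e he) (sub_nonneg.2 (hM e he)))).1 hsum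
    have hsubs : (V.filter fun j => l (x j) = l z).image x ⊆ V.image x :=
      Finset.image_subset_image (Finset.filter_subset _ _)
    have hc : ∀ e ∈ V.image x, e ∉ (V.filter fun j => l (x j) = l z).image x → c e = 0 := by
      intro e he heY
      rcases mul_eq_zero.1 (hzero e he) with h | h
      · exact h
      · exfalso
        obtain ⟨j, hj, rfl⟩ := Finset.mem_image.1 he
        exact heY (Finset.mem_image_of_mem x (Finset.mem_filter.2 ⟨hj, by linarith⟩))
    have : w ∈ convexHull ℝ (((V.filter fun j => l (x j) = l z).image x : Finset E) : Set E) := by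
      rw [Finset.mem_convexHull']
      refine ⟨c, fun e he => c0 e (hsubs he), ?_, ?_⟩
      · rw [← c1]
        exact Finset.sum_subset hsubs hc
      · rw [← cw]
        exact Finset.sum_subset hsubs (fun e he heY => by rw [hc e he heY, zero_smul])
    rw [Finset.coe_image] at this
    exact this
  · intro w hw
    have hwV := hex'.subset hw
    have : hul x (V.filter fun j => l (x j) = l z) ⊆ {y | l y = l z} := by
      apply convexHull_min
      · rintro _ ⟨j, hj, rfl⟩
        exact (Finset.mem_filter.1 hj).2
      · exact convex_hyperplane l.toLinearMap.isLinear _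
    rw [hl]
    refine ⟨hwV, fun y hy => ?_⟩
    have hwl : l w = l z := this hw
    rw [hwl]
    exact hle y hy

/-- Separation of a finite-dimensional subspace from a point outside it. -/
lemma exists_sep (D : Submodule ℝ E) [FiniteDimensional ℝ D] {u : E} (hu : u ∉ D) :
    ∃ g : E →L[ℝ] ℝ, (∀ b ∈ D, g b = 0) ∧ g u ≠ 0 := by
  obtain ⟨f, s, h1, h2⟩ := geometric_hahn_banach_point_closed (x := u) (t := (D : Set E))
    D.convex D.closed_of_finiteDimensional hu
  have hs : s < 0 := by simpa using h2 0 D.zero_mem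
  refine ⟨f, fun b hb => ?_, by linarith⟩
  by_contra hne
  have := h2 ((s / f b) • b) (D.smul_mem _ hb)
  rw [map_smul, smul_eq_mul, div_mul_cancel₀ _ hne] at this
  exact lt_irrefl _ this

/-- Every supported set is the intersection of supported sets of codimension one. -/
lemma exists_facet {V : Finset ℤ} {x : ℤ → E} {d : ℕ} (hd : pd x V = d) {v : ℤ} (hv : v ∈ V) :
    ∀ (m : ℕ) (Y : Finset ℤ), (V \ Y).card = m → Y.Nonempty → IsSupp V x Y → v ∉ Y →
      ∃ Z, IsSupp V x Z ∧ Y ⊆ Z ∧ v ∉ Z ∧ pd x Z = d - 1 := by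
  intro m
  induction m using Nat.strong_induction_on with
  | _ m ih =>
  intro Y hm hne hY hvY
  have hlt : pd x Y < d := hd ▸ pd_lt hY hne subset_rfl hY.1 hv hvY
  by_cases hfac : pd x Y = d - 1
  · exact ⟨Y, hY, subset_rfl, hvY, hfac⟩
  have hY2 := hY
  obtain ⟨hYV, l, M, hl⟩ := hY2
  obtain ⟨y, hy⟩ := hne
  -- the span of `Y ∪ {v}` is too small
  have hins : pd x (insert v Y) ≤ pd x Y + 1 := by
    have := finrank_vectorSpan_insert_le_set ℝ (x '' (Y : Set ℤ)) (x v)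
    rw [← Set.image_insert_eq, ← Finset.coe_insert] at this
    exact this
  have hnle : ¬ (vectorSpan ℝ (x '' (V : Set ℤ)) ≤
      vectorSpan ℝ (x '' ((insert v Y : Finset ℤ) : Set ℤ))) := by
    intro hle
    have := fd_span x (insert v Y)
    have := Submodule.finrank_mono hle
    change pd x V ≤ pd x (insert v Y) at this
    omega
  obtain ⟨u, huV, hu⟩ := SetLike.not_le_iff_exists.1 hnle
  have := fd_span x (insert v Y)
  obtain ⟨g, hg0, hgu⟩ := exists_sep _ hu
  have hgY : ∀ j ∈ insert v Y, g (x j) = g (x y) := by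
    intro j hj
    have := hg0 (x j -ᵥ x y) (vsub_mem_vectorSpan ℝ ⟨j, hj, rfl⟩
      ⟨y, Finset.mem_insert_of_mem hy, rfl⟩)
    simp only [vsub_eq_sub, map_sub] at this
    linarith
  have hex : ∃ w ∈ V, g (x w) ≠ g (x y) := by
    by_contra hcon
    push Not at hcon
    exact hgu (span_le_ker x V g (g (x y)) hcon huV)
  obtain ⟨w, hwV, hw⟩ := hex
  have hex2 : ∃ h : E →L[ℝ] ℝ, (∀ j ∈ insert v Y, h (x j) = h (x y)) ∧ h (x y) < h (x w) := by
    rcases lt_or_gt_of_ne hw with h | h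
    · refine ⟨-g, fun j hj => ?_, ?_⟩
      · simp [hgY j hj]
      · simpa using h
    · exact ⟨g, hgY, h⟩
  obtain ⟨h, hhY, hhw⟩ := hex2
  set S := V.filter (fun j => h (x y) < h (x j)) with hS
  obtain ⟨j0, hj0, hmin⟩ := Finset.exists_min_image S
    (fun j => (M - l (x j)) / (h (x j) - h (x y))) ⟨w, Finset.mem_filter.2 ⟨hwV, hhw⟩⟩
  set t := (M - l (x j0)) / (h (x j0) - h (x y)) with ht
  have hj0' := Finset.mem_filter.1 hj0
  have hden : 0 < h (x j0) - h (x y) := sub_pos.2 hj0'.2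
  have ht0 : 0 ≤ t := div_nonneg (sub_nonneg.2 (hl j0 hj0'.1).1) hden.le
  have hle : ∀ j ∈ V, (l + t • h) (x j) ≤ M + t * h (x y) := by
    intro j hj
    simp only [add_apply, smul_apply, smul_eq_mul]
    have hjM := (hl j hj).1
    rcases le_or_gt (h (x j)) (h (x y)) with hc | hc
    · nlinarith
    · have h1 := hmin j (Finset.mem_filter.2 ⟨hj, hc⟩)
      rw [le_div_iff₀ (sub_pos.2 hc)] at h1
      nlinarith
  set Y' := V.filter (fun j => (l + t • h) (x j) = M + t * h (x y)) with hY'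
  have hsY' : IsSupp V x Y' :=
    ⟨Finset.filter_subset _ _, l + t • h, M + t * h (x y), fun j hj =>
      ⟨hle j hj, by simp only [hY', Finset.mem_filter, hj, true_and]⟩⟩
  have hYY' : Y ⊆ Y' := by
    intro j hj
    refine Finset.mem_filter.2 ⟨hYV hj, ?_⟩
    simp only [add_apply, smul_apply, smul_eq_mul]
    rw [hhY j (Finset.mem_insert_of_mem hj), (hl j (hYV hj)).2.2 hj]
  have hvY' : v ∉ Y' := by
    intro hc
    have := (Finset.mem_filter.1 hc).2
    simp only [add_apply, smul_apply, smul_eq_mul] at this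
    rw [hhY v (Finset.mem_insert_self _ _)] at this
    exact hvY ((hl v hv).2.1 (by linarith))
  have hj0Y' : j0 ∈ Y' := by
    refine Finset.mem_filter.2 ⟨hj0'.1, ?_⟩
    simp only [add_apply, smul_apply, smul_eq_mul]
    have : t * (h (x j0) - h (x y)) = M - l (x j0) := div_mul_cancel₀ _ hden.ne'
    linarith
  have hj0Y : j0 ∉ Y := by
    intro hc
    have := hhY j0 (Finset.mem_insert_of_mem hc)
    linarith [hj0'.2]
  have hcard : (V \ Y').card < m := by
    rw [← hm]
    apply Finset.card_lt_card
    refine ⟨Finset.sdiff_subset_sdiff subset_rfl hYY', fun hc => ?_⟩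
    have := hc (Finset.mem_sdiff.2 ⟨hj0'.1, hj0Y⟩)
    exact (Finset.mem_sdiff.1 this).2 hj0Y'
  obtain ⟨Z, h1, h2, h3, h4⟩ := ih _ hcard Y' rfl ⟨y, hYY' hy⟩ hsY' hvY'
  exact ⟨Z, h1, hYY'.trans h2, h3, h4⟩

end Geometry

section Combinatorics

/-- vertex indices -/
noncomputable def mV (n : ℕ) : Finset ℤ := Finset.Icc 0 (n : ℤ)

/-- vertex indices of the facet `F i` -/
noncomputable def mF (d n : ℕ) (i : ℤ) : Finset ℤ :=
  (mV n).filter fun j => i - d + 1 ≤ j ∧ j ≤ i + d - 1 ∧ (j ≠ i ∨ j = 0 ∨ j = n)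

/-- intersections of facets -/
noncomputable def mI (d n : ℕ) (I : Finset ℤ) : Finset ℤ := (mV n).filter fun j => ∀ i ∈ I, j ∈ mF d n i

/-- `Y` is an intersection of facets. -/
def mCl (d n : ℕ) (Y : Finset ℤ) : Prop :=
  ∀ v ∈ mV n, v ∉ Y → ∃ i ∈ mV n, Y ⊆ mF d n i ∧ v ∉ mF d n i

/-- short faces -/
def TA (d n : ℕ) (Y : Finset ℤ) : Prop :=
  (∃ c : ℤ, Y ⊆ Finset.Icc c (c + d - 2)) ∨ Y ⊆ Finset.Icc 0 ((d : ℤ) - 1) ∨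
    Y ⊆ Finset.Icc ((n : ℤ) - d + 1) n

/-- index sets of long faces -/
def TB (d n : ℕ) (I : Finset ℤ) : Prop :=
  ∃ v : ℤ, 0 ≤ v ∧ v ≤ n - d ∧ I ⊆ Finset.Icc (v + 1) (v + d - 1)

lemma mem_mV {n : ℕ} {j : ℤ} : j ∈ mV n ↔ 0 ≤ j ∧ j ≤ n := by simp [mV]

lemma mem_mF {d n : ℕ} {i j : ℤ} : j ∈ mF d n i ↔ (0 ≤ j ∧ j ≤ n) ∧
    i - d + 1 ≤ j ∧ j ≤ i + d - 1 ∧ (j ≠ i ∨ j = 0 ∨ j = n) := by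
  simp [mF, mem_mV]

lemma mem_mI {d n : ℕ} {I : Finset ℤ} {j : ℤ} :
    j ∈ mI d n I ↔ (0 ≤ j ∧ j ≤ n) ∧ ∀ i ∈ I, j ∈ mF d n i := by
  simp [mI, mem_mV]

lemma exists_minmax {Y : Finset ℤ} (h : Y.Nonempty) :
    ∃ p ∈ Y, ∃ q ∈ Y, ∀ y ∈ Y, p ≤ y ∧ y ≤ q :=
  ⟨Y.min' h, Y.min'_mem h, Y.max' h, Y.max'_mem h, fun y hy => ⟨Y.min'_le y hy, Y.le_max' y hy⟩⟩

lemma cl_left {d n : ℕ} (hd : 2 ≤ d) (hdn : d ≤ n) {Y : Finset ℤ}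
    (h : Y ⊆ Finset.Icc 0 ((d : ℤ) - 1)) : mCl d n Y := by
  intro v hv hvY
  rw [mem_mV] at hv
  have hY : ∀ y ∈ Y, 0 ≤ y ∧ y ≤ (d : ℤ) - 1 ∧ y ≠ v := fun y hy => by
    have := Finset.mem_Icc.1 (h hy)
    exact ⟨this.1, this.2, fun e => hvY (e ▸ hy)⟩
  rcases lt_or_ge v d with h1 | h1
  · rcases eq_or_ne v 0 with h0 | h0
    · refine ⟨d, mem_mV.2 (by omega), fun y hy => ?_, ?_⟩
      · have := hY y hy
        rw [mem_mF]; omega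
      · rw [mem_mF]; omega
    · refine ⟨v, mem_mV.2 hv, fun y hy => ?_, ?_⟩
      · have := hY y hy
        rw [mem_mF]; omega
      · rw [mem_mF]; omega
  · refine ⟨0, mem_mV.2 (by omega), fun y hy => ?_, ?_⟩
    · have := hY y hy
      rw [mem_mF]; omega
    · rw [mem_mF]; omega

lemma cl_right {d n : ℕ} (hd : 2 ≤ d) (hdn : d ≤ n) {Y : Finset ℤ}
    (h : Y ⊆ Finset.Icc ((n : ℤ) - d + 1) n) : mCl d n Y := by
  intro v hv hvY
  rw [mem_mV] at hv
  have hY : ∀ y ∈ Y, (n : ℤ) - d + 1 ≤ y ∧ y ≤ n ∧ y ≠ v := fun y hy => by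
    have := Finset.mem_Icc.1 (h hy)
    exact ⟨this.1, this.2, fun e => hvY (e ▸ hy)⟩
  rcases lt_or_ge ((n : ℤ) - d) v with h1 | h1
  · rcases eq_or_ne v n with h0 | h0
    · refine ⟨n - d, mem_mV.2 (by omega), fun y hy => ?_, ?_⟩
      · have := hY y hy
        rw [mem_mF]; omega
      · rw [mem_mF]; omega
    · refine ⟨v, mem_mV.2 hv, fun y hy => ?_, ?_⟩
      · have := hY y hy
        rw [mem_mF]; omega
      · rw [mem_mF]; omega
  · refine ⟨n, mem_mV.2 (by omega), fun y hy => ?_, ?_⟩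
    · have := hY y hy
      rw [mem_mF]; omega
    · rw [mem_mF]; omega

lemma cl_TA {d n : ℕ} (hd : 2 ≤ d) (hdn : d ≤ n) {Y : Finset ℤ} (hne : Y.Nonempty)
    (hV : Y ⊆ mV n) (h : TA d n Y) : mCl d n Y := by
  rcases h with ⟨c, h⟩ | h | h
  · obtain ⟨p, hp, q, hq, hpq⟩ := exists_minmax hne
    have hpc := Finset.mem_Icc.1 (h hp)
    have hqc := Finset.mem_Icc.1 (h hq)
    have hpV := mem_mV.1 (hV hp)
    have hqV := mem_mV.1 (hV hq)
    by_cases hl : q ≤ d - 1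
    · refine cl_left hd hdn fun y hy => Finset.mem_Icc.2 ?_
      have := hpq y hy
      omega
    by_cases hr : (n : ℤ) - d + 1 ≤ p
    · refine cl_right hd hdn fun y hy => Finset.mem_Icc.2 ?_
      have := hpq y hy
      omega
    intro v hv hvY
    rw [mem_mV] at hv
    have hY : ∀ y ∈ Y, p ≤ y ∧ y ≤ q ∧ y ≠ v := fun y hy =>
      ⟨(hpq y hy).1, (hpq y hy).2, fun e => hvY (e ▸ hy)⟩
    rcases lt_or_ge v p with h1 | h1
    · refine ⟨p + d - 1, mem_mV.2 (by omega), fun y hy => ?_, ?_⟩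
      · have := hY y hy
        rw [mem_mF]; omega
      · rw [mem_mF]; omega
    rcases lt_or_ge q v with h2 | h2
    · refine ⟨q - d + 1, mem_mV.2 (by omega), fun y hy => ?_, ?_⟩
      · have := hY y hy
        rw [mem_mF]; omega
      · rw [mem_mF]; omega
    · refine ⟨v, mem_mV.2 (by omega), fun y hy => ?_, ?_⟩
      · have := hY y hy
        rw [mem_mF]; omega
      · have h3 := hY p hp
        have h4 := hY q hq
        rw [mem_mF]; omega
  · exact cl_left hd hdn h
  · exact cl_right hd hdn h

lemma TA_mono {d n : ℕ} {Y Z : Finset ℤ} (h : TA d n Y) (hZ : Z ⊆ Y) : TA d n Z := by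
  rcases h with ⟨c, h⟩ | h | h
  · exact Or.inl ⟨c, hZ.trans h⟩
  · exact Or.inr (Or.inl (hZ.trans h))
  · exact Or.inr (Or.inr (hZ.trans h))

lemma TB_sub {d n : ℕ} (hdn : d ≤ n) {I : Finset ℤ} (h : TB d n I) :
    ∀ i ∈ I, 1 ≤ i ∧ i ≤ n - 1 := by
  obtain ⟨v, h1, h2, h3⟩ := h
  intro i hi
  have := Finset.mem_Icc.1 (h3 hi)
  omega

lemma cl_mI {d n : ℕ} {I : Finset ℤ} (hI : I ⊆ mV n) : mCl d n (mI d n I) := by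
  intro v hv hvI
  rw [mem_mI, not_and] at hvI
  have := hvI (mem_mV.1 hv)
  push Not at this
  obtain ⟨i, hi, hvi⟩ := this
  exact ⟨i, hI hi, fun y hy => (mem_mI.1 hy).2 i hi, hvi⟩

lemma classify {d n : ℕ} (hd : 2 ≤ d) (hdn : d ≤ n) {Y : Finset ℤ} (hne : Y.Nonempty)
    (hV : Y ⊆ mV n) (hY : mCl d n Y) (hYV : Y ≠ mV n) :
    TA d n Y ∨ ∃ I : Finset ℤ, I.Nonempty ∧ TB d n I ∧ Y = mI d n I := by
  obtain ⟨p, hp, q, hq, hpq⟩ := exists_minmax hne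
  have hpV := mem_mV.1 (hV hp)
  have hqV := mem_mV.1 (hV hq)
  set J := (mV n).filter (fun i => Y ⊆ mF d n i) with hJ
  have hYJ : Y = mI d n J := by
    ext j
    rw [mem_mI]
    constructor
    · intro hj
      exact ⟨mem_mV.1 (hV hj), fun i hi => (Finset.mem_filter.1 hi).2 hj⟩
    · rintro ⟨hj, hj2⟩
      by_contra hjY
      obtain ⟨i, hi, h1, h2⟩ := hY j (mem_mV.2 hj) hjY
      exact h2 (hj2 i (Finset.mem_filter.2 ⟨hi, h1⟩))
  have hJp : ∀ i ∈ J, p ∈ mF d n i := fun i hi => (Finset.mem_filter.1 hi).2 hp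
  have hJq : ∀ i ∈ J, q ∈ mF d n i := fun i hi => (Finset.mem_filter.1 hi).2 hq
  have hJn : J.Nonempty := by
    have : ∃ v ∈ mV n, v ∉ Y := by
      by_contra hc
      push Not at hc
      exact hYV (Finset.Subset.antisymm hV hc)
    obtain ⟨v, hv, hvY⟩ := this
    obtain ⟨i, hi, h1, -⟩ := hY v hv hvY
    exact ⟨i, Finset.mem_filter.2 ⟨hi, h1⟩⟩
  by_cases h1 : q - p ≤ d - 2
  · left; left
    refine ⟨p, fun y hy => Finset.mem_Icc.2 ?_⟩
    have := hpq y hy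
    omega
  by_cases h2 : d ≤ q - p
  · right
    refine ⟨J, hJn, ⟨min p (n - d), by omega, by omega, fun i hi => Finset.mem_Icc.2 ?_⟩, hYJ⟩
    have a := mem_mF.1 (hJp i hi)
    have b := mem_mF.1 (hJq i hi)
    omega
  by_cases h3 : p = 0
  · left; right; left
    refine fun y hy => Finset.mem_Icc.2 ?_
    have := hpq y hy
    omega
  by_cases h4 : q = n
  · left; right; right
    refine fun y hy => Finset.mem_Icc.2 ?_
    have := hpq y hy
    omega
  exfalso
  have : p - 1 ∈ Y := by
    rw [hYJ, mem_mI]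
    refine ⟨by omega, fun i hi => ?_⟩
    have a := mem_mF.1 (hJp i hi)
    have b := mem_mF.1 (hJq i hi)
    rw [mem_mF]
    omega
  have := hpq _ this
  omega

lemma mI_ends {d n : ℕ} (hd : 2 ≤ d) (hdn : d ≤ n) {I : Finset ℤ} {v : ℤ} (h0 : 0 ≤ v)
    (h1 : v ≤ n - d) (h : I ⊆ Finset.Icc (v + 1) (v + d - 1)) :
    v ∈ mI d n I ∧ v + d ∈ mI d n I := by
  constructor
  · rw [mem_mI]
    refine ⟨by omega, fun i hi => ?_⟩
    have := Finset.mem_Icc.1 (h hi)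
    rw [mem_mF]; omega
  · rw [mem_mI]
    refine ⟨by omega, fun i hi => ?_⟩
    have := Finset.mem_Icc.1 (h hi)
    rw [mem_mF]; omega

lemma mI_inj {d n : ℕ} (hd : 2 ≤ d) (hdn : d ≤ n) {I I' : Finset ℤ} (h : TB d n I)
    (he : mI d n I = mI d n I') : I ⊆ I' := by
  have hs := TB_sub hdn h
  obtain ⟨v, h0, h1, h2⟩ := h
  intro w hw
  have hwr := hs w hw
  have hwI := Finset.mem_Icc.1 (h2 hw)
  by_contra hwI'
  obtain ⟨e1, e2⟩ := mI_ends hd hdn h0 h1 h2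
  have hn : w ∉ mI d n I := by
    intro hc
    have := mem_mF.1 ((mem_mI.1 hc).2 w hw)
    omega
  rw [he] at hn e1 e2
  apply hn
  rw [mem_mI]
  refine ⟨by omega, fun i hi => ?_⟩
  have a1 := mem_mF.1 ((mem_mI.1 e1).2 i hi)
  have a2 := mem_mF.1 ((mem_mI.1 e2).2 i hi)
  have : w ≠ i := fun e => hwI' (e ▸ hi)
  rw [mem_mF]
  omega

lemma TA_ne_TB {d n : ℕ} (hd : 2 ≤ d) (hdn : d ≤ n) {I : Finset ℤ} (h : TB d n I)
    (hA : TA d n (mI d n I)) : False := by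
  obtain ⟨v, h0, h1, h2⟩ := h
  obtain ⟨e1, e2⟩ := mI_ends hd hdn h0 h1 h2
  rcases hA with ⟨c, h⟩ | h | h
  all_goals
    have a1 := Finset.mem_Icc.1 (h e1)
    have a2 := Finset.mem_Icc.1 (h e2)
    omega

/-! Counting -/

/-- subsets of size `j` of some window of length `w` starting in `[s, s+L]` -/
noncomputable def win (s : ℤ) (w L j : ℕ) : Finset (Finset ℤ) :=
  ((Finset.Icc 0 (L : ℤ)).biUnion fun v => (Finset.Icc (s + v) (s + v + w - 1)).powersetCard j)

lemma mem_win {s : ℤ} {w L j : ℕ} {Y : Finset ℤ} : Y ∈ win s w L j ↔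
    (∃ v : ℤ, 0 ≤ v ∧ v ≤ L ∧ Y ⊆ Finset.Icc (s + v) (s + v + w - 1)) ∧ Y.card = j := by
  simp only [win, Finset.mem_biUnion, Finset.mem_Icc, Finset.mem_powersetCard]
  constructor
  · rintro ⟨v, h1, h2, h3⟩; exact ⟨⟨v, h1.1, h1.2, h2⟩, h3⟩
  · rintro ⟨⟨v, h1, h2, h3⟩, h4⟩; exact ⟨v, ⟨h1, h2⟩, h3, h4⟩

lemma card_win (s : ℤ) (w L j : ℕ) :
    (win s (w + 1) L (j + 1)).card = (w + 1).choose (j + 1) + L * w.choose j := by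
  induction L with
  | zero =>
    have : win s (w + 1) 0 (j + 1) = (Finset.Icc s (s + w)).powersetCard (j + 1) := by
      simp only [win, Nat.cast_zero, Finset.Icc_self, Finset.singleton_biUnion]
      congr 2 <;> push_cast <;> ring
    rw [this, Finset.card_powersetCard, Int.card_Icc]
    simp only [zero_mul, add_zero]
    congr 1
    omega
  | succ L ih =>
    have key : win s (w + 1) (L + 1) (j + 1) = win s (w + 1) L (j + 1) ∪
        ((Finset.Icc (s + L + 1) (s + L + w)).powersetCard j).image
          (insert (s + L + w + 1)) := by
      ext Y
      rw [Finset.mem_union, mem_win, mem_win, Finset.mem_image]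
      constructor
      · rintro ⟨⟨v, h1, h2, h3⟩, h4⟩
        by_cases htop : s + L + w + 1 ∈ Y
        · right
          refine ⟨Y.erase (s + L + w + 1), ?_, Finset.insert_erase htop⟩
          rw [Finset.mem_powersetCard, Finset.card_erase_of_mem htop, h4]
          refine ⟨fun y hy => ?_, rfl⟩
          rw [Finset.mem_erase] at hy
          have a := Finset.mem_Icc.1 (h3 hy.2)
          have b := Finset.mem_Icc.1 (h3 htop)
          push_cast at *
          rw [Finset.mem_Icc]
          omega
        · left
          refine ⟨⟨min v L, by omega, by omega, fun y hy => ?_⟩, h4⟩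
          have a := Finset.mem_Icc.1 (h3 hy)
          have : y ≠ s + L + w + 1 := fun e => htop (e ▸ hy)
          push_cast at *
          rw [Finset.mem_Icc]
          omega
      · rintro (⟨⟨v, h1, h2, h3⟩, h4⟩ | ⟨Z, hZ, rfl⟩)
        · exact ⟨⟨v, h1, by push_cast; omega, h3⟩, h4⟩
        · rw [Finset.mem_powersetCard] at hZ
          have hn : s + L + w + 1 ∉ Z := fun hc => by
            have := Finset.mem_Icc.1 (hZ.1 hc)
            omega
          refine ⟨⟨L + 1, by omega, by push_cast; omega, fun y hy => ?_⟩, ?_⟩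
          · rw [Finset.mem_insert] at hy
            rw [Finset.mem_Icc]
            push_cast
            rcases hy with rfl | hy
            · omega
            · have := Finset.mem_Icc.1 (hZ.1 hy)
              omega
          · rw [Finset.card_insert_of_notMem hn, hZ.2]
    rw [key, Finset.card_union_of_disjoint, ih, Finset.card_image_of_injOn,
      Finset.card_powersetCard, Int.card_Icc]
    · have : (s + L + w + 1 - (s + L + 1)).toNat = w := by omega
      rw [this]; ring
    · intro Z hZ Z' hZ' he
      have hZ := Finset.mem_powersetCard.1 (Finset.mem_coe.1 hZ)
      have hZ' := Finset.mem_powersetCard.1 (Finset.mem_coe.1 hZ')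
      have hn : s + L + w + 1 ∉ Z := fun hc => by
        have := Finset.mem_Icc.1 (hZ.1 hc)
        omega
      have hn' : s + L + w + 1 ∉ Z' := fun hc => by
        have := Finset.mem_Icc.1 (hZ'.1 hc)
        omega
      rw [← Finset.erase_insert hn, he, Finset.erase_insert hn']
    · rw [Finset.disjoint_left]
      intro Y hY hY2
      obtain ⟨⟨v, h1, h2, h3⟩, -⟩ := mem_win.1 hY
      obtain ⟨Z, hZ, rfl⟩ := Finset.mem_image.1 hY2
      have := Finset.mem_Icc.1 (h3 (Finset.mem_insert_self _ _))
      push_cast at this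
      omega

/-- subsets of size `j+2` of `[s, s+e+1]` containing both ends -/
noncomputable def ends (s : ℤ) (e j : ℕ) : Finset (Finset ℤ) :=
  ((Finset.Icc (s + 1) (s + e)).powersetCard j).image fun Z => insert s (insert (s + e + 1) Z)

lemma mem_ends {s : ℤ} {e j : ℕ} {Y : Finset ℤ} : Y ∈ ends s e j ↔
    Y ⊆ Finset.Icc s (s + e + 1) ∧ s ∈ Y ∧ s + e + 1 ∈ Y ∧ Y.card = j + 2 := by
  simp only [ends, Finset.mem_image, Finset.mem_powersetCard]
  constructor
  · rintro ⟨Z, ⟨h1, h2⟩, rfl⟩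
    have n1 : s ∉ Z := fun hc => by
      have := Finset.mem_Icc.1 (h1 hc)
      omega
    have n2 : s + e + 1 ∉ Z := fun hc => by
      have := Finset.mem_Icc.1 (h1 hc)
      omega
    refine ⟨fun y hy => ?_, by simp, by simp, ?_⟩
    · rw [Finset.mem_insert, Finset.mem_insert] at hy
      rw [Finset.mem_Icc]
      rcases hy with rfl | rfl | hy
      · omega
      · omega
      · have := Finset.mem_Icc.1 (h1 hy)
        omega
    · rw [Finset.card_insert_of_notMem, Finset.card_insert_of_notMem n2, h2]
      rw [Finset.mem_insert]
      rintro (h | h)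
      · omega
      · exact n1 h
  · rintro ⟨h1, h2, h3, h4⟩
    have h3' : s + e + 1 ∈ Y.erase s := Finset.mem_erase.2 ⟨by omega, h3⟩
    refine ⟨(Y.erase s).erase (s + e + 1), ⟨fun y hy => ?_, ?_⟩, ?_⟩
    · rw [Finset.mem_erase, Finset.mem_erase] at hy
      have := Finset.mem_Icc.1 (h1 hy.2.2)
      rw [Finset.mem_Icc]
      omega
    · rw [Finset.card_erase_of_mem h3', Finset.card_erase_of_mem h2]
      omega
    · rw [Finset.insert_erase h3', Finset.insert_erase h2]

lemma card_ends (s : ℤ) (e j : ℕ) : (ends s e j).card = e.choose j := by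
  rw [ends, Finset.card_image_of_injOn, Finset.card_powersetCard, Int.card_Icc]
  · congr 1; omega
  · intro Z hZ Z' hZ' he
    have hZ := Finset.mem_powersetCard.1 (Finset.mem_coe.1 hZ)
    have hZ' := Finset.mem_powersetCard.1 (Finset.mem_coe.1 hZ')
    ext y
    have hy : y ∈ insert s (insert (s + e + 1) Z) ↔ y ∈ insert s (insert (s + e + 1) Z') := by
      simp only at he
      rw [he]
    simp only [Finset.mem_insert] at hy
    constructor
    · intro h
      have := Finset.mem_Icc.1 (hZ.1 h)
      rcases hy.1 (Or.inr (Or.inr h)) with h | h | h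
      · omega
      · omega
      · exact h
    · intro h
      have := Finset.mem_Icc.1 (hZ'.1 h)
      rcases hy.2 (Or.inr (Or.inr h)) with h | h | h
      · omega
      · omega
      · exact h

end Combinatorics

section Assembly

variable {d n : ℕ} {P : Set E} {x : ℤ → E}

lemma hP (hM : IsMultiplex d n P x) : P = hul x (mV n) := by
  rw [hM.hull, hul, mV, Finset.coe_Icc]

lemma mem_hul (hM : IsMultiplex d n P x) {Y : Finset ℤ} (hY : Y ⊆ mV n) {j : ℤ} (hj : j ∈ mV n) :
    x j ∈ hul x Y ↔ j ∈ Y := by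
  constructor
  · intro h
    have hsub : hul x Y ⊆ P := by
      rw [hP hM]
      exact convexHull_mono (Set.image_mono (by exact_mod_cast hY))
    have hext : x j ∈ P.extremePoints ℝ := by
      rw [hM.verts]
      exact ⟨j, mem_mV.1 hj, rfl⟩
    have h2 : x j ∈ (hul x Y).extremePoints ℝ :=
      inter_extremePoints_subset_extremePoints_of_subset hsub ⟨h, hext⟩
    obtain ⟨j', hj', he⟩ := extremePoints_convexHull_subset h2
    have := hM.inj (mem_mV.1 (hY hj')) (mem_mV.1 hj) he
    exact this ▸ hj'
  · intro h
    exact subset_convexHull ℝ _ ⟨j, h, rfl⟩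

lemma hul_inj (hM : IsMultiplex d n P x) {Y Z : Finset ℤ} (hY : Y ⊆ mV n) (hZ : Z ⊆ mV n)
    (h : hul x Y = hul x Z) : Y = Z := by
  apply Finset.Subset.antisymm
  · intro j hj
    rw [← mem_hul hM hZ (hY hj), ← h]
    exact (mem_hul hM hY (hY hj)).2 hj
  · intro j hj
    rw [← mem_hul hM hY (hZ hj), h]
    exact (mem_hul hM hZ (hZ hj)).2 hj

lemma mF_sub (d n : ℕ) (i : ℤ) : mF d n i ⊆ mV n := Finset.filter_subset _ _

lemma mI_sub (d n : ℕ) (I : Finset ℤ) : mI d n I ⊆ mV n := Finset.filter_subset _ _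

lemma image_mF (hM : IsMultiplex d n P x) {i : ℤ} (hi : i ∈ mV n) :
    x '' (Icc (i - d + 1) (i + d - 1) \ {i}) = x '' (mF d n i : Set ℤ) := by
  have hd := hM.two_le_d
  have hdn := hM.d_le_n
  rw [mem_mV] at hi
  apply Set.Subset.antisymm
  · rintro _ ⟨j, ⟨hj, hji⟩, rfl⟩
    rw [Set.mem_Icc] at hj
    rw [Set.mem_singleton_iff] at hji
    rcases lt_or_ge j 0 with h | h
    · refine ⟨0, ?_, (hM.clamp_lo j h.le).symm⟩
      rw [Finset.mem_coe, mem_mF]; omega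
    rcases lt_or_ge (n : ℤ) j with h' | h'
    · refine ⟨n, ?_, (hM.clamp_hi j h'.le).symm⟩
      rw [Finset.mem_coe, mem_mF]; omega
    · refine ⟨j, ?_, rfl⟩
      rw [Finset.mem_coe, mem_mF]; omega
  · rintro _ ⟨j, hj, rfl⟩
    rw [Finset.mem_coe, mem_mF] at hj
    by_cases hji : j = i
    · rcases hj.2.2.2 with h | h | h
      · exact absurd hji h
      · refine ⟨-1, ⟨?_, ?_⟩, ?_⟩
        · rw [Set.mem_Icc]; omega
        · rw [Set.mem_singleton_iff]; omega
        · rw [hM.clamp_lo (-1) (by omega), h]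
      · refine ⟨n + 1, ⟨?_, ?_⟩, ?_⟩
        · rw [Set.mem_Icc]; omega
        · rw [Set.mem_singleton_iff]; omega
        · rw [hM.clamp_hi (n + 1) (by omega), h]
    · refine ⟨j, ⟨?_, ?_⟩, rfl⟩
      · rw [Set.mem_Icc]; omega
      · rw [Set.mem_singleton_iff]; omega

lemma facets_iff (hM : IsMultiplex d n P x) (F : Set E) :
    (IsFaceOf P F ∧ pdim F = d - 1) ↔ ∃ i ∈ mV n, F = hul x (mF d n i) := by
  rw [hM.facets]
  constructor
  · rintro ⟨i, hi, rfl⟩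
    refine ⟨i, mem_mV.2 hi, ?_⟩
    rw [image_mF hM (mem_mV.2 hi)]; rfl
  · rintro ⟨i, hi, rfl⟩
    refine ⟨i, mem_mV.1 hi, ?_⟩
    rw [image_mF hM hi]; rfl

lemma pd_mV (hM : IsMultiplex d n P x) : pd x (mV n) = d := by
  rw [← pdim_hul, ← hP hM, hM.dim]

lemma face_iff (hM : IsMultiplex d n P x) {Y : Finset ℤ} (hY : Y ⊆ mV n) :
    IsFaceOf P (hul x Y) ↔ Y.Nonempty ∧ IsSupp (mV n) x Y := by
  constructor
  · intro h
    rw [hP hM] at h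
    obtain ⟨Z, h1, h2, h3⟩ := face_supp h
    rw [hul_inj hM hY h2.1 h3]
    exact ⟨h1, h2⟩
  · rintro ⟨h1, h2⟩
    rw [hP hM]
    exact supp_face h2 h1

lemma supp_mF (hM : IsMultiplex d n P x) {i : ℤ} (hi : i ∈ mV n) : IsSupp (mV n) x (mF d n i) :=
  ((face_iff hM (mF_sub d n i)).1 ((facets_iff hM _).2 ⟨i, hi, rfl⟩).1).2

lemma supp_iff (hM : IsMultiplex d n P x) {Y : Finset ℤ} (hY : Y ⊆ mV n) (hne : Y.Nonempty) :
    IsSupp (mV n) x Y ↔ mCl d n Y := by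
  classical
  constructor
  · intro h v hv hvY
    obtain ⟨Z, h1, h2, h3, h4⟩ := exists_facet (pd_mV hM) hv _ Y rfl hne h hvY
    have hZ : IsFaceOf P (hul x Z) := (face_iff hM h1.1).2 ⟨hne.mono h2, h1⟩
    obtain ⟨i, hi, he⟩ := (facets_iff hM (hul x Z)).1 ⟨hZ, by rw [pdim_hul, h4]⟩
    have := hul_inj hM h1.1 (mF_sub d n i) he
    subst this
    exact ⟨i, hi, h2, h3⟩
  · intro h
    have gen : ∀ J : Finset ℤ, J ⊆ mV n → IsSupp (mV n) x (mI d n J) := by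
      intro J
      induction J using Finset.induction_on with
      | empty =>
        intro _
        have : mI d n ∅ = mV n := by simp [mI]
        rw [this]
        exact supp_univ _ _
      | insert a J ha ih =>
        intro hJ
        have : mI d n (insert a J) = mF d n a ∩ mI d n J := by
          ext j
          rw [Finset.mem_inter, mem_mI, mem_mI, mem_mF]
          simp only [Finset.mem_insert, forall_eq_or_imp, mem_mF]
          tauto
        rw [this]
        exact supp_inter (supp_mF hM (hJ (Finset.mem_insert_self _ _)))
          (ih fun j hj => hJ (Finset.mem_insert_of_mem hj))
    have : Y = mI d n ((mV n).filter fun i => Y ⊆ mF d n i) := by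
      ext j
      rw [mem_mI]
      constructor
      · intro hj
        exact ⟨mem_mV.1 (hY hj), fun i hi => (Finset.mem_filter.1 hi).2 hj⟩
      · rintro ⟨hj, hj2⟩
        by_contra hjY
        obtain ⟨i, hi, h1, h2⟩ := h j (mem_mV.2 hj) hjY
        exact h2 (hj2 i (Finset.mem_filter.2 ⟨hi, h1⟩))
    rw [this]
    exact gen _ (Finset.filter_subset _ _)

lemma pd_TA (hM : IsMultiplex d n P x) : ∀ (k : ℕ) (Y : Finset ℤ), Y ⊆ mV n → TA d n Y →
    Y.card = k + 1 → pd x Y = k := by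
  intro k
  induction k with
  | zero =>
    intro Y _ _ hc
    exact Nat.le_zero.1 (pd_le_card x Y 0 hc)
  | succ k ih =>
    intro Y hY hA hc
    apply le_antisymm (pd_le_card x Y _ hc)
    obtain ⟨w, hw⟩ : Y.Nonempty := Finset.card_pos.1 (by omega)
    have hc' : (Y.erase w).card = k + 1 := by rw [Finset.card_erase_of_mem hw, hc]; rfl
    have hne : (Y.erase w).Nonempty := Finset.card_pos.1 (by omega)
    have hsub : Y.erase w ⊆ Y := Finset.erase_subset _ _
    have hA' := TA_mono hA hsub
    have h1 := ih _ (hsub.trans hY) hA' hc'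
    have h2 : IsSupp (mV n) x (Y.erase w) := (supp_iff hM (hsub.trans hY) hne).2
      (cl_TA hM.two_le_d hM.d_le_n hne (hsub.trans hY) hA')
    have := pd_lt h2 hne hY hsub hw (Finset.notMem_erase _ _)
    omega

lemma supp_mI (hM : IsMultiplex d n P x) {I : Finset ℤ} (hI : TB d n I) :
    (mI d n I).Nonempty ∧ IsSupp (mV n) x (mI d n I) := by
  have hs := TB_sub hM.d_le_n hI
  obtain ⟨v, h0, h1, h2⟩ := hI
  have hne : (mI d n I).Nonempty := ⟨v, (mI_ends hM.two_le_d hM.d_le_n h0 h1 h2).1⟩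
  refine ⟨hne, (supp_iff hM (mI_sub d n I) hne).2 (cl_mI fun i hi => mem_mV.2 ?_)⟩
  have := hs i hi
  omega

lemma pd_step (hM : IsMultiplex d n P x) {I : Finset ℤ} {w : ℤ} (hw : w ∉ I)
    (hI : TB d n (insert w I)) : pd x (mI d n (insert w I)) < pd x (mI d n I) := by
  obtain ⟨h1, h2⟩ := supp_mI hM hI
  have hs := TB_sub hM.d_le_n hI
  have hwn := hs w (Finset.mem_insert_self _ _)
  have hd := hM.two_le_d
  refine pd_lt h2 h1 (mI_sub d n I) (fun j hj => ?_) (w := w) ?_ ?_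
  · rw [mem_mI] at hj ⊢
    exact ⟨hj.1, fun i hi => hj.2 i (Finset.mem_insert_of_mem hi)⟩
  · obtain ⟨v, h3, h4, h5⟩ := hI
    have a := Finset.mem_Icc.1 (h5 (Finset.mem_insert_self _ _))
    rw [mem_mI]
    refine ⟨by omega, fun i hi => ?_⟩
    have b := Finset.mem_Icc.1 (h5 (Finset.mem_insert_of_mem hi))
    have : w ≠ i := fun e => hw (e ▸ hi)
    rw [mem_mF]
    omega
  · intro hc
    have := mem_mF.1 ((mem_mI.1 hc).2 w (Finset.mem_insert_self _ _))
    omega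

lemma TB_mono {I J : Finset ℤ} (hI : TB d n I) (h : J ⊆ I) : TB d n J := by
  obtain ⟨v, h1, h2, h3⟩ := hI
  exact ⟨v, h1, h2, h.trans h3⟩

lemma pd_TB_le (hM : IsMultiplex d n P x) (I : Finset ℤ) (hI : TB d n I) :
    pd x (mI d n I) + I.card ≤ d := by
  induction I using Finset.induction_on with
  | empty =>
    have : mI d n ∅ = mV n := by simp [mI]
    rw [this, pd_mV hM]; simp
  | insert a J ha ih =>
    have h1 := ih (TB_mono hI (Finset.subset_insert _ _))
    have h2 := pd_step hM ha hI
    rw [Finset.card_insert_of_notMem ha]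
    omega

lemma pd_TB_ge (hM : IsMultiplex d n P x) {v : ℤ} (hv : 0 ≤ v) (hv' : v ≤ n - d) :
    ∀ (m : ℕ) (I : Finset ℤ), I ⊆ Finset.Icc (v + 1) (v + d - 1) → I.card + m + 1 = d →
      m + 1 ≤ pd x (mI d n I) := by
  have hd := hM.two_le_d
  have hdn := hM.d_le_n
  intro m
  induction m with
  | zero =>
    intro I hI _
    obtain ⟨e1, e2⟩ := mI_ends hd hdn hv hv' hI
    have hsub : ({v} : Finset ℤ) ⊆ mV n := by
      rw [Finset.singleton_subset_iff, mem_mV]; omega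
    have hs : IsSupp (mV n) x {v} := by
      refine (supp_iff hM hsub (Finset.singleton_nonempty v)).2
        (cl_TA hd hdn (Finset.singleton_nonempty v) hsub (Or.inl ⟨v, ?_⟩))
      rw [Finset.singleton_subset_iff, Finset.mem_Icc]; omega
    have := pd_lt hs (Finset.singleton_nonempty v) (mI_sub d n I)
      (Finset.singleton_subset_iff.2 e1) e2 (by rw [Finset.mem_singleton]; omega)
    omega
  | succ m ih =>
    intro I hI hc
    have hlt : I.card < (Finset.Icc (v + 1) (v + (d : ℤ) - 1)).card := by
      rw [Int.card_Icc]; omega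
    obtain ⟨w, hw, hwI⟩ := Finset.exists_mem_notMem_of_card_lt_card hlt
    have hsub : insert w I ⊆ Finset.Icc (v + 1) (v + (d : ℤ) - 1) :=
      Finset.insert_subset hw hI
    have h1 := ih _ hsub (by rw [Finset.card_insert_of_notMem hwI]; omega)
    have h2 := pd_step hM hwI ⟨v, hv, hv', hsub⟩
    omega

lemma pd_TB (hM : IsMultiplex d n P x) (I : Finset ℤ) (hI : TB d n I) :
    pd x (mI d n I) + I.card = d := by
  have h1 := pd_TB_le hM I hI
  obtain ⟨v, h0, h2, h3⟩ := hI
  have hd := hM.two_le_d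
  have hc : I.card ≤ d - 1 := by
    have := Finset.card_le_card h3
    rw [Int.card_Icc] at this
    omega
  have := pd_TB_ge hM h0 h2 (d - 1 - I.card) I h3 (by omega)
  omega

open Classical in
/-- index sets of the `k`-faces, short ones -/
noncomputable def FA (d n k : ℕ) : Finset (Finset ℤ) :=
  ((mV n).powersetCard (k + 1)).filter fun Y => TA d n Y

lemma mem_FA {k : ℕ} {Y : Finset ℤ} :
    Y ∈ FA d n k ↔ Y ∈ (mV n).powersetCard (k + 1) ∧ TA d n Y := by
  simp only [FA, Finset.mem_filter]

/-- index sets of the `k`-faces, long ones -/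
noncomputable def FB (d n k : ℕ) : Finset (Finset ℤ) :=
  (win 1 (d - 1) (n - d) (d - k)).image (mI d n)

lemma mem_winB (hd : 2 ≤ d) (hdn : d ≤ n) {I : Finset ℤ} {j : ℕ} :
    I ∈ win 1 (d - 1) (n - d) j ↔ TB d n I ∧ I.card = j := by
  have key : ∀ v : ℤ, v + 1 + ((d - 1 : ℕ) : ℤ) - 1 = v + d - 1 := fun v => by omega
  have key2 : ((n - d : ℕ) : ℤ) = n - d := by omega
  rw [mem_win, TB]
  simp only [add_comm (1 : ℤ), key, key2]

lemma FF_sub {k : ℕ} {Y : Finset ℤ} (h : Y ∈ FA d n k ∪ FB d n k) : Y ⊆ mV n := by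
  rw [Finset.mem_union] at h
  rcases h with h | h
  · exact (Finset.mem_powersetCard.1 (mem_FA.1 h).1).1
  · obtain ⟨I, -, rfl⟩ := Finset.mem_image.1 h
    exact mI_sub d n I

lemma faces_iff (hM : IsMultiplex d n P x) {k : ℕ} (hk : k ≤ d - 1) (F : Set E) :
    (IsFaceOf P F ∧ pdim F = k) ↔ ∃ Y ∈ FA d n k ∪ FB d n k, F = hul x Y := by
  have hd := hM.two_le_d
  have hdn := hM.d_le_n
  constructor
  · rintro ⟨hF, hdim⟩
    have hF' := hF
    rw [hP hM] at hF'
    obtain ⟨Y, hne, hs, rfl⟩ := face_supp hF'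
    rw [pdim_hul] at hdim
    refine ⟨Y, ?_, rfl⟩
    have hcl := (supp_iff hM hs.1 hne).1 hs
    have hYV : Y ≠ mV n := by
      rintro rfl
      rw [pd_mV hM] at hdim
      omega
    rw [Finset.mem_union]
    rcases classify hd hdn hne hs.1 hcl hYV with hA | ⟨I, hI, hB, rfl⟩
    · left
      have hc := Finset.card_pos.2 hne
      have := pd_TA hM (Y.card - 1) Y hs.1 hA (by omega)
      exact mem_FA.2 ⟨Finset.mem_powersetCard.2 ⟨hs.1, by omega⟩, hA⟩
    · right
      have := pd_TB hM I hB
      exact Finset.mem_image.2 ⟨I, (mem_winB hd hdn).2 ⟨hB, by omega⟩, rfl⟩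
  · rintro ⟨Y, hY, rfl⟩
    have hYV := FF_sub hY
    rw [pdim_hul, face_iff hM hYV]
    rw [Finset.mem_union] at hY
    rcases hY with h | h
    · obtain ⟨h1, hA⟩ := mem_FA.1 h
      have hc := (Finset.mem_powersetCard.1 h1).2
      have hne : Y.Nonempty := Finset.card_pos.1 (by omega)
      exact ⟨⟨hne, (supp_iff hM hYV hne).2 (cl_TA hd hdn hne hYV hA)⟩, pd_TA hM k Y hYV hA hc⟩
    · obtain ⟨I, hI, rfl⟩ := Finset.mem_image.1 h
      obtain ⟨hB, hc⟩ := (mem_winB hd hdn).1 hI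
      refine ⟨supp_mI hM hB, ?_⟩
      have := pd_TB hM I hB
      omega

lemma hul_singleton (x : ℤ → E) (v : ℤ) : hul x {v} = {x v} := by
  simp [hul]

lemma zero_faces (hM : IsMultiplex d n P x) (F : Set E) :
    (IsFaceOf P F ∧ pdim F = 0) ↔ ∃ v ∈ mV n, F = {x v} := by
  have hd := hM.two_le_d
  have hdn := hM.d_le_n
  rw [faces_iff hM (Nat.zero_le _)]
  constructor
  · rintro ⟨Y, hY, rfl⟩
    have hYV := FF_sub hY
    rw [Finset.mem_union] at hY
    rcases hY with h | h
    · obtain ⟨h1, hA⟩ := mem_FA.1 h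
      obtain ⟨v, rfl⟩ := Finset.card_eq_one.1 (Finset.mem_powersetCard.1 h1).2
      exact ⟨v, hYV (Finset.mem_singleton_self v), hul_singleton x v⟩
    · exfalso
      obtain ⟨I, hI, rfl⟩ := Finset.mem_image.1 h
      obtain ⟨⟨v, -, -, hB⟩, hc⟩ := (mem_winB hd hdn).1 hI
      have := Finset.card_le_card hB
      rw [Int.card_Icc] at this
      omega
  · rintro ⟨v, hv, rfl⟩
    refine ⟨{v}, ?_, (hul_singleton x v).symm⟩
    rw [Finset.mem_union]
    left
    refine mem_FA.2 ⟨Finset.mem_powersetCard.2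
      ⟨Finset.singleton_subset_iff.2 hv, by simp⟩, Or.inl ⟨v, ?_⟩⟩
    rw [Finset.singleton_subset_iff, Finset.mem_Icc]; omega

lemma flag_zero (hM : IsMultiplex d n P x) : flagNum P {0, 0} = n + 1 := by
  have hset : {c : ℕ → Set E | (∀ s ∈ ({0, 0} : Finset ℕ), IsFaceOf P (c s) ∧ pdim (c s) = s) ∧
      (∀ s ∈ ({0, 0} : Finset ℕ), ∀ t ∈ ({0, 0} : Finset ℕ), s ≤ t → c s ⊆ c t) ∧
      ∀ s, s ∉ ({0, 0} : Finset ℕ) → c s = ∅} =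
      (fun (v : ℤ) (s : ℕ) => if s = 0 then ({x v} : Set E) else ∅) '' (mV n : Set ℤ) := by
    ext c
    simp only [Finset.pair_eq_singleton, Finset.mem_singleton, forall_eq, Set.mem_ofPred_eq,
      Set.mem_image, Finset.mem_coe]
    constructor
    · rintro ⟨h1, -, h3⟩
      obtain ⟨v, hv, he⟩ := (zero_faces hM (c 0)).1 h1
      refine ⟨v, hv, ?_⟩
      funext s
      by_cases hs : s = 0
      · subst hs; simp [he]
      · simp [hs, h3 s hs]
    · rintro ⟨v, hv, rfl⟩
      refine ⟨(zero_faces hM _).2 ⟨v, hv, by simp⟩, fun _ => subset_rfl, fun s hs => by simp [hs]⟩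
  unfold flagNum
  rw [hset, Set.InjOn.ncard_image, Set.ncard_coe_finset, mV, Int.card_Icc]
  · omega
  · intro v hv w hw he
    have := congrFun he 0
    simp only [if_true, Set.singleton_eq_singleton_iff] at this
    exact hM.inj (mem_mV.1 hv) (mem_mV.1 hw) this

lemma flag_pos (hM : IsMultiplex d n P x) {k : ℕ} (hk0 : k ≠ 0) (hk : k ≤ d - 1) :
    flagNum P {0, k} = ∑ Y ∈ FA d n k ∪ FB d n k, Y.card := by
  have hset : {c : ℕ → Set E | (∀ s ∈ ({0, k} : Finset ℕ), IsFaceOf P (c s) ∧ pdim (c s) = s) ∧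
      (∀ s ∈ ({0, k} : Finset ℕ), ∀ t ∈ ({0, k} : Finset ℕ), s ≤ t → c s ⊆ c t) ∧
      ∀ s, s ∉ ({0, k} : Finset ℕ) → c s = ∅} =
      (fun (p : (_ : Finset ℤ) × ℤ) (s : ℕ) => if s = 0 then ({x p.2} : Set E) else
        if s = k then hul x p.1 else ∅) ''
        (((FA d n k ∪ FB d n k).sigma fun Y => Y : Finset ((_ : Finset ℤ) × ℤ)) :
          Set ((_ : Finset ℤ) × ℤ)) := by
    ext c
    simp only [Finset.mem_insert, Finset.mem_singleton, forall_eq_or_imp, forall_eq,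
      Set.mem_ofPred_eq, Set.mem_image, Finset.mem_coe, Finset.mem_sigma, Sigma.exists]
    constructor
    · rintro ⟨⟨h1, h2⟩, ⟨⟨-, h3⟩, -⟩, h4⟩
      obtain ⟨v, hv, he⟩ := (zero_faces hM (c 0)).1 h1
      obtain ⟨Y, hY, he'⟩ := (faces_iff hM hk (c k)).1 h2
      have hsub := h3 (Nat.zero_le _)
      rw [he, he', Set.singleton_subset_iff, mem_hul hM (FF_sub hY) hv] at hsub
      refine ⟨Y, v, ⟨hY, hsub⟩, ?_⟩
      funext s
      by_cases hs : s = 0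
      · subst hs; simp [he]
      by_cases hs' : s = k
      · subst hs'; simp [hs, he']
      · simp [hs, hs', h4 s (by tauto)]
    · rintro ⟨Y, v, ⟨hY, hvY⟩, rfl⟩
      have hvV := FF_sub hY hvY
      refine ⟨⟨?_, ?_⟩, ⟨⟨fun _ => subset_rfl, fun _ => ?_⟩, fun h => ?_, fun _ => subset_rfl⟩,
        fun s hs => ?_⟩
      · exact (zero_faces hM _).2 ⟨v, hvV, by simp⟩
      · exact (faces_iff hM hk _).2 ⟨Y, hY, by simp [hk0]⟩
      · simpa [hk0] using (mem_hul hM (FF_sub hY) hvV).2 hvY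
      · exact absurd (Nat.le_zero.1 h) hk0
      · rw [not_or] at hs
        simp [hs.1, hs.2]
  unfold flagNum
  rw [hset, Set.InjOn.ncard_image, Set.ncard_coe_finset, Finset.card_sigma]
  rintro ⟨Y, v⟩ hv ⟨Z, w⟩ hw he
  rw [Finset.mem_coe, Finset.mem_sigma] at hv hw
  have h0 := congrFun he 0
  have hk' := congrFun he k
  simp only [if_true, Set.singleton_eq_singleton_iff] at h0
  simp only [hk0, if_true, if_false] at hk'
  have hYZ := hul_inj hM (FF_sub hv.1) (FF_sub hw.1) hk'
  have hvw := hM.inj (mem_mV.1 (FF_sub hv.1 hv.2)) (mem_mV.1 (FF_sub hw.1 hw.2)) h0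
  subst hYZ
  subst hvw
  rfl

end Assembly

section Final

lemma card_mI {d n k : ℕ} (hd : 2 ≤ d) (hdn : d ≤ n) (hk : k ≤ d - 1) {I : Finset ℤ}
    (hI : TB d n I) (hc : I.card = d - k) :
    (mI d n I).card = k + ((Finset.Icc 0 ((n : ℤ) - d)).filter
      fun v => I ⊆ Finset.Icc (v + 1) (v + d - 1)).card := by
  have hs := TB_sub hdn hI
  obtain ⟨v, hv0, hv1, hv⟩ := hI
  obtain ⟨a, ha, b, hb, hab⟩ := exists_minmax (Y := I) (Finset.card_pos.1 (by omega))
  have hav := Finset.mem_Icc.1 (hv ha)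
  have hbv := Finset.mem_Icc.1 (hv hb)
  have hsub : I ⊆ Finset.Icc (min a (n - d + 1)) (min a (n - d + 1) + d - 1) := by
    intro i hi
    have := hab i hi
    have := hs i hi
    rw [Finset.mem_Icc]
    omega
  have key : mI d n I = (Finset.Icc (min a (n - d + 1)) (min a (n - d + 1) + d - 1) \ I) ∪
      ((Finset.Icc 0 ((n : ℤ) - d)).filter fun v => I ⊆ Finset.Icc (v + 1) (v + d - 1)) := by
    ext j
    rw [Finset.mem_union, Finset.mem_sdiff, Finset.mem_filter, Finset.mem_Icc, Finset.mem_Icc,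
      mem_mI]
    constructor
    · rintro ⟨hj, hj2⟩
      have h1 := mem_mF.1 (hj2 a ha)
      have h2 := mem_mF.1 (hj2 b hb)
      have hjI : j ∉ I := by
        intro hc
        have h3 := mem_mF.1 (hj2 j hc)
        have h4 := hs j hc
        omega
      by_cases hja : min a ((n : ℤ) - d + 1) ≤ j
      · left
        exact ⟨by omega, hjI⟩
      · right
        refine ⟨by omega, fun i hi => ?_⟩
        have := hab i hi
        rw [Finset.mem_Icc]
        omega
    · rintro (⟨hj, hjI⟩ | ⟨hj, hjI⟩)
      · have := hs a ha
        refine ⟨by omega, fun i hi => ?_⟩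
        have h1 := hab i hi
        have h2 := Finset.mem_Icc.1 (hsub hi)
        have : j ≠ i := fun e => hjI (e ▸ hi)
        rw [mem_mF]
        omega
      · refine ⟨by omega, fun i hi => ?_⟩
        have h1 := Finset.mem_Icc.1 (hjI hi)
        rw [mem_mF]
        omega
  rw [key, Finset.card_union_of_disjoint, Finset.card_sdiff_of_subset hsub, Int.card_Icc, hc]
  · congr 1
    omega
  · rw [Finset.disjoint_left]
    intro j hj hj2
    have h1 := Finset.mem_Icc.1 (Finset.mem_sdiff.1 hj).1
    obtain ⟨h2, h3⟩ := Finset.mem_filter.1 hj2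
    have h4 := Finset.mem_Icc.1 (h3 ha)
    rw [Finset.mem_Icc] at h2
    omega

lemma sum_FB {e N r : ℕ} (hr : r ≤ e) :
    ∑ Y ∈ FB (e + 2) (e + 2 + N) (r + 1), Y.card =
      (r + 1) * ((e + 1).choose r + N * e.choose r) + (N + 1) * (e + 1).choose r := by
  have hd : 2 ≤ e + 2 := by omega
  have hdn : e + 2 ≤ e + 2 + N := by omega
  have hj : e + 2 - (r + 1) = (e - r) + 1 := by omega
  have hc1 : (e + 1).choose (e - r + 1) = (e + 1).choose r :=
    Nat.choose_symm_of_eq_add (by omega)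
  have hc2 : e.choose (e - r) = e.choose r := Nat.choose_symm hr
  rw [FB, Finset.sum_image]
  · have h1 : ∀ I ∈ win 1 (e + 2 - 1) (e + 2 + N - (e + 2)) (e + 2 - (r + 1)),
        (mI (e + 2) (e + 2 + N) I).card = (r + 1) +
          ∑ v ∈ Finset.Icc (0 : ℤ) (((e + 2 + N : ℕ) : ℤ) - ((e + 2 : ℕ) : ℤ)),
            if I ⊆ Finset.Icc (v + 1) (v + ((e + 2 : ℕ) : ℤ) - 1) then 1 else 0 := by
      intro I hI
      obtain ⟨hB, hc⟩ := (mem_winB hd hdn).1 hI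
      rw [card_mI hd hdn (by omega) hB hc, Finset.card_filter]
    rw [Finset.sum_congr rfl h1, Finset.sum_add_distrib, Finset.sum_comm, Finset.sum_const]
    have h2 : ∀ v ∈ Finset.Icc (0 : ℤ) (((e + 2 + N : ℕ) : ℤ) - ((e + 2 : ℕ) : ℤ)),
        (∑ I ∈ win 1 (e + 2 - 1) (e + 2 + N - (e + 2)) (e + 2 - (r + 1)),
          if I ⊆ Finset.Icc (v + 1) (v + ((e + 2 : ℕ) : ℤ) - 1) then 1 else 0) =
          (e + 1).choose r := by
      intro v hv
      rw [Finset.mem_Icc] at hv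
      rw [← Finset.card_filter]
      have : (win 1 (e + 2 - 1) (e + 2 + N - (e + 2)) (e + 2 - (r + 1))).filter
          (fun I => I ⊆ Finset.Icc (v + 1) (v + ((e + 2 : ℕ) : ℤ) - 1)) =
          (Finset.Icc (v + 1) (v + ((e + 2 : ℕ) : ℤ) - 1)).powersetCard (e - r + 1) := by
        ext I
        rw [Finset.mem_filter, mem_winB hd hdn, Finset.mem_powersetCard, hj]
        constructor
        · rintro ⟨⟨-, h⟩, h'⟩; exact ⟨h', h⟩
        · rintro ⟨h, h'⟩; exact ⟨⟨⟨v, hv.1, hv.2, h⟩, h'⟩, h⟩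
      rw [this, Finset.card_powersetCard, Int.card_Icc, ← hc1]
      congr 1
      omega
    rw [Finset.sum_congr rfl h2, Finset.sum_const, Int.card_Icc, hj]
    have e1 : e + 2 - 1 = e + 1 := by omega
    have e2 : e + 2 + N - (e + 2) = N := by omega
    have e3 : (((e + 2 + N : ℕ) : ℤ) - ((e + 2 : ℕ) : ℤ) + 1 - 0).toNat = N + 1 := by omega
    rw [e1, e2, e3, card_win, hc1, hc2, smul_eq_mul, smul_eq_mul]
    ring
  · intro I hI I' hI' he
    have h1 := ((mem_winB hd hdn).1 (Finset.mem_coe.1 hI)).1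
    have h2 := ((mem_winB hd hdn).1 (Finset.mem_coe.1 hI')).1
    exact Finset.Subset.antisymm (mI_inj hd hdn h1 he) (mI_inj hd hdn h2 he.symm)

lemma card_FA (e N r : ℕ) :
    (FA (e + 2) (e + 2 + N) (r + 1)).card =
      (e + 1).choose (r + 2) + (N + 2) * e.choose (r + 1) + 2 * e.choose r := by
  have key : FA (e + 2) (e + 2 + N) (r + 1) =
      (win 0 (e + 1) (N + 2) (r + 1 + 1) ∪ ends 0 e r) ∪ ends (N + 1) e r := by
    ext Y
    rw [Finset.mem_union, Finset.mem_union, mem_win, mem_ends, mem_ends, mem_FA,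
      Finset.mem_powersetCard]
    constructor
    · rintro ⟨⟨hV, hc⟩, hA⟩
      obtain ⟨p, hp, q, hq, hpq⟩ := exists_minmax (Y := Y) (Finset.card_pos.1 (by omega))
      have hpV := mem_mV.1 (hV hp)
      have hqV := mem_mV.1 (hV hq)
      have hpq' := hpq p hp
      by_cases hs : q - p ≤ e
      · left; left
        refine ⟨⟨min p (N + 2), by omega, by push_cast; omega, fun y hy => ?_⟩, hc⟩
        have := hpq y hy
        have := mem_mV.1 (hV hy)
        rw [Finset.mem_Icc]
        push_cast at *
        omega
      rcases hA with ⟨c, h⟩ | h | h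
      · have h1 := Finset.mem_Icc.1 (h hp)
        have h2 := Finset.mem_Icc.1 (h hq)
        push_cast at *
        omega
      · have h1 := Finset.mem_Icc.1 (h hp)
        have h2 := Finset.mem_Icc.1 (h hq)
        push_cast at *
        have hp0 : p = 0 := by omega
        have hq0 : q = 0 + e + 1 := by omega
        left; right
        refine ⟨fun y hy => ?_, hp0 ▸ hp, hq0 ▸ hq, by omega⟩
        have := hpq y hy
        rw [Finset.mem_Icc]
        omega
      · have h1 := Finset.mem_Icc.1 (h hp)
        have h2 := Finset.mem_Icc.1 (h hq)
        push_cast at *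
        have hp0 : p = N + 1 := by omega
        have hq0 : q = N + 1 + e + 1 := by omega
        right
        refine ⟨fun y hy => ?_, hp0 ▸ hp, hq0 ▸ hq, by omega⟩
        have := hpq y hy
        rw [Finset.mem_Icc]
        omega
    · rintro ((⟨⟨v, h1, h2, h3⟩, h4⟩ | ⟨h1, h2, h3, h4⟩) | ⟨h1, h2, h3, h4⟩)
      · refine ⟨⟨fun y hy => ?_, h4⟩, Or.inl ⟨v, fun y hy => ?_⟩⟩
        · have := Finset.mem_Icc.1 (h3 hy)
          rw [mem_mV]
          push_cast at *
          omega
        · have := Finset.mem_Icc.1 (h3 hy)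
          rw [Finset.mem_Icc]
          push_cast at *
          omega
      · refine ⟨⟨fun y hy => ?_, h4⟩, Or.inr (Or.inl fun y hy => ?_)⟩
        · have := Finset.mem_Icc.1 (h1 hy)
          rw [mem_mV]
          push_cast at *
          omega
        · have := Finset.mem_Icc.1 (h1 hy)
          rw [Finset.mem_Icc]
          push_cast at *
          omega
      · refine ⟨⟨fun y hy => ?_, h4⟩, Or.inr (Or.inr fun y hy => ?_)⟩
        · have := Finset.mem_Icc.1 (h1 hy)
          rw [mem_mV]
          push_cast at *
          omega
        · have := Finset.mem_Icc.1 (h1 hy)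
          rw [Finset.mem_Icc]
          push_cast at *
          omega
  rw [key, Finset.card_union_of_disjoint, Finset.card_union_of_disjoint, card_win, card_ends,
    card_ends]
  · ring
  · rw [Finset.disjoint_left]
    intro Y h1 h2
    obtain ⟨⟨v, a1, a2, a3⟩, -⟩ := mem_win.1 h1
    obtain ⟨-, b2, b3, -⟩ := mem_ends.1 h2
    have c1 := Finset.mem_Icc.1 (a3 b2)
    have c2 := Finset.mem_Icc.1 (a3 b3)
    push_cast at *
    omega
  · rw [Finset.disjoint_left]
    intro Y h1 h2
    obtain ⟨-, b2, b3, -⟩ := mem_ends.1 h2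
    rcases Finset.mem_union.1 h1 with h1 | h1
    · obtain ⟨⟨v, a1, a2, a3⟩, -⟩ := mem_win.1 h1
      have c1 := Finset.mem_Icc.1 (a3 b2)
      have c2 := Finset.mem_Icc.1 (a3 b3)
      push_cast at *
      omega
    · obtain ⟨a1, -, -, -⟩ := mem_ends.1 h1
      have c2 := Finset.mem_Icc.1 (a1 b3)
      omega

lemma sum_FF {e N r : ℕ} (hr : r ≤ e) :
    ∑ Y ∈ FA (e + 2) (e + 2 + N) (r + 1) ∪ FB (e + 2) (e + 2 + N) (r + 1), Y.card =
      (r + 2) * ((e + 1).choose (r + 2) + (N + 2) * e.choose (r + 1) + 2 * e.choose r) +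
      ((r + 1) * ((e + 1).choose r + N * e.choose r) + (N + 1) * (e + 1).choose r) := by
  rw [Finset.sum_union, sum_FB hr, ← card_FA e N r]
  · congr 1
    rw [Finset.sum_const_nat (m := r + 2), mul_comm]
    intro Y hY
    exact (Finset.mem_powersetCard.1 (mem_FA.1 hY).1).2
  · rw [Finset.disjoint_left]
    intro Y hA hB
    obtain ⟨I, hI, rfl⟩ := Finset.mem_image.1 hB
    exact TA_ne_TB (by omega) (by omega) ((mem_winB (by omega) (by omega)).1 hI).1 (mem_FA.1 hA).2

lemma arith {e N r : ℕ} :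
    ((r : ℤ) + 2) * ((e + 1).choose (r + 2) + (N + 2) * e.choose (r + 1) + 2 * e.choose r) +
      ((r + 1) * ((e + 1).choose r + N * e.choose r) + (N + 1) * (e + 1).choose r) =
    ((e : ℤ) + 2 + N + 1) * (e + 2).choose (r + 1) + e * N * e.choose r := by
  have hB : ((r : ℤ) + 1) * e.choose (r + 1) = (e - r) * e.choose r := by
    rcases le_or_gt r e with h | h
    · have := Nat.choose_succ_right_eq e r
      have h2 : ((e - r : ℕ) : ℤ) = e - r := by omega
      rw [← h2]
      have h3 : ((e.choose (r + 1) * (r + 1) : ℕ) : ℤ) = ((e.choose r * (e - r) : ℕ) : ℤ) := by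
        rw [this]
      push_cast at h3
      linarith
    · rw [Nat.choose_eq_zero_of_lt h, Nat.choose_eq_zero_of_lt (by omega : e < r + 1)]; simp
  have hD : ((r : ℤ) + 2) * e.choose (r + 2) = (e - r - 1) * e.choose (r + 1) := by
    rcases le_or_gt (r + 1) e with h | h
    · have := Nat.choose_succ_right_eq e (r + 1)
      have h2 : ((e - (r + 1) : ℕ) : ℤ) = e - r - 1 := by omega
      rw [← h2]
      have h3 : ((e.choose (r + 1 + 1) * (r + 1 + 1) : ℕ) : ℤ) =
          ((e.choose (r + 1) * (e - (r + 1)) : ℕ) : ℤ) := by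
        rw [this]
      push_cast at h3
      linarith
    · rw [Nat.choose_eq_zero_of_lt h, Nat.choose_eq_zero_of_lt (by omega : e < r + 2)]; simp
  have hZ : ((e : ℤ) + 1 - r) * (e + 1).choose r = (e + 1) * e.choose r := by
    rcases le_or_gt r (e + 1) with h | h
    · have := Nat.add_one_mul_choose_eq e r
      have h4 := Nat.choose_succ_right_eq (e + 1) r
      have h2 : ((e + 1 - r : ℕ) : ℤ) = e + 1 - r := by omega
      rw [← h2]
      have h3 : (((e + 1) * e.choose r : ℕ) : ℤ) = (((e + 1).choose r * (e + 1 - r) : ℕ) : ℤ) := by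
        rw [← h4, ← this]
      push_cast at h3
      linarith
    · rw [Nat.choose_eq_zero_of_lt h, Nat.choose_eq_zero_of_lt (by omega : e < r)]; simp
  have p1 : ((e + 1).choose (r + 2) : ℤ) = e.choose (r + 1) + e.choose (r + 2) := by
    exact_mod_cast Nat.choose_succ_succ e (r + 1)
  have p2 : ((e + 2).choose (r + 1) : ℤ) = (e + 1).choose r + (e.choose r + e.choose (r + 1)) := by
    rw [Nat.choose_succ_succ (e + 1) r, Nat.choose_succ_succ e r]
    push_cast
    ring
  rw [p1, p2]
  linear_combination ((N : ℤ) + 2) * hB + hD - hZ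

end Final

/-- The number of incident (vertex, `i`-face) pairs of the multiplex `M^{d,n}` is
`f_{0,i} = (n+1)·C(d,i) + (d-2)(n-d)·C(d-2, i-1)`. -/
theorem multiplex_f0i (d n i : ℕ) (hd : 2 ≤ d) (hdn : d ≤ n) (hi : i ≤ d - 1)
    (P : Set E) (x : ℤ → E) (hM : IsMultiplex d n P x) :
    (flagNum P {0, i} : ℤ) =
      ((n : ℤ) + 1) * Cz (d : ℤ) (i : ℤ) +
        ((d : ℤ) - 2) * ((n : ℤ) - (d : ℤ)) * Cz ((d : ℤ) - 2) ((i : ℤ) - 1) := by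
  obtain ⟨e, rfl⟩ : ∃ e, d = e + 2 := ⟨d - 2, by omega⟩
  obtain ⟨N, rfl⟩ : ∃ N, n = e + 2 + N := ⟨n - (e + 2), by omega⟩
  have c1 : (((e + 2 : ℕ) : ℤ)).toNat = e + 2 := by omega
  have c2 : (((e + 2 : ℕ) : ℤ) - 2).toNat = e := by omega
  rcases Nat.eq_zero_or_pos i with h0 | h0
  · subst h0
    rw [flag_zero hM]
    have a1 : Cz ((e + 2 : ℕ) : ℤ) ((0 : ℕ) : ℤ) = 1 := by
      rw [Cz, if_pos ⟨by omega, by omega⟩]; simp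
    have a2 : Cz (((e + 2 : ℕ) : ℤ) - 2) (((0 : ℕ) : ℤ) - 1) = 0 := by
      rw [Cz, if_neg (by omega)]
    rw [a1, a2]
    push_cast
    ring
  · obtain ⟨r, rfl⟩ : ∃ r, i = r + 1 := ⟨i - 1, by omega⟩
    rw [flag_pos hM (by omega) hi, sum_FF (by omega)]
    have c3 : (((r + 1 : ℕ) : ℤ)).toNat = r + 1 := by omega
    have c4 : (((r + 1 : ℕ) : ℤ) - 1).toNat = r := by omega
    have a1 : Cz ((e + 2 : ℕ) : ℤ) ((r + 1 : ℕ) : ℤ) = (e + 2).choose (r + 1) := by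
      rw [Cz, if_pos ⟨by omega, by omega⟩, c1, c3]
    have a2 : Cz (((e + 2 : ℕ) : ℤ) - 2) (((r + 1 : ℕ) : ℤ) - 1) = e.choose r := by
      rw [Cz, if_pos ⟨by omega, by omega⟩, c2, c4]
    rw [a1, a2]
    have := @arith e N r
    push_cast
    rw [this]
    ring
end
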